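/- arXiv:2105.06302 — 2 statements merged into one kernel-verified Lean document; each statement's English description precedes it below -/
import Mathlib

section
/- Each (e,y)-ladder class of partitions contains a unique (e,y)-regular partition, and this partition dominates every partition in the class. -/
def IsPartition (p : ℕ → ℕ) : Prop :=
  p 0 = 0 ∧ (∀ r, 1 ≤ r → p (r + 1) ≤ p r) ∧ (∃ N, ∀ r, N ≤ r → p r = 0)

noncomputable def conj (p : ℕ → ℕ) : ℕ → ℕ :=
  fun r => Set.ncard {c : ℕ | 1 ≤ c ∧ r ≤ p c}

noncomputable def psize (p : ℕ → ℕ) : ℕ := ∑' r, p r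

noncomputable def Dominates (p q : ℕ → ℕ) : Prop :=
  psize p = psize q ∧
    ∀ n, ∑ r ∈ Finset.Icc 1 n, q r ≤ ∑ r ∈ Finset.Icc 1 n, p r

def cells (p : ℕ → ℕ) : Set (ℤ × ℤ) :=
  {x | 1 ≤ x.1 ∧ 1 ≤ x.2 ∧ x.2 ≤ (p x.1.toNat : ℤ)}

def Ladder (e y : ℤ) (r c : ℤ) : Set (ℤ × ℤ) :=
  {x | ∃ k : ℤ, x = (r + k * (y - e), c + k * y)}

noncomputable def LadderEquiv (e y : ℤ) (p q : ℕ → ℕ) : Prop :=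
  ∀ r c : ℤ, (Ladder e y r c ∩ cells p).ncard = (Ladder e y r c ∩ cells q).ncard

/-- `p` has a hook of length `len` and arm length `arm`. -/
noncomputable def HasHook (p : ℕ → ℕ) (len arm : ℕ) : Prop :=
  ∃ r c : ℕ, 1 ≤ r ∧ 1 ≤ c ∧ c ≤ p r ∧
    (p r - c) + (conj p c - r) + 1 = len ∧ p r - c = arm

/-- `p` is `(e,y)`-regular: no hook of length `et` and arm length `yt - 1`. -/
noncomputable def EYRegular (e y : ℕ) (p : ℕ → ℕ) : Prop :=
  ∀ t : ℕ, 1 ≤ t → ¬ HasHook p (e * t) (y * t - 1)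


namespace LR

structure Walk (g : ℤ → ℤ) : Prop where
  step : ∀ s, g (s+1) = g s ∨ g (s+1) = g s - 1
  bd : ∃ N : ℤ, (∀ s, N ≤ s → g s = 0) ∧ (∀ s, s ≤ -N → g s = -s)

def X (e f : ℤ) (g : ℤ → ℤ) (S r : ℤ) : Set ℤ := {k | g (S + k * e) < r - k * f}

def TEq (e f : ℤ) (g g' : ℤ → ℤ) : Prop := ∀ S r, (X e f g S r).ncard = (X e f g' S r).ncard

def WReg (e f : ℤ) (g : ℤ → ℤ) : Prop :=
  ∀ s t, 1 ≤ t → g (s + t * e) = g s - t * f → g (s+1) = g s → g (s + t * e + 1) = g (s + t * e)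

lemma Walk.anti {g : ℤ → ℤ} (h : Walk g) : Antitone g := by
  apply antitone_int_of_succ_le
  intro s; rcases h.step s with h | h <;> omega

lemma Walk.mono {g : ℤ → ℤ} (h : Walk g) : Monotone (fun s => g s + s) := by
  apply monotone_int_of_le_succ
  intro s; rcases h.step s with h | h <;> simp only [h] <;> omega

lemma Walk.nonneg {g : ℤ → ℤ} (h : Walk g) (s : ℤ) : 0 ≤ g s := by
  obtain ⟨N, h1, _⟩ := h.bd
  have := h.anti (le_max_left s N)
  rw [h1 _ (le_max_right s N)] at this
  exact this

lemma Walk.neg_le {g : ℤ → ℤ} (h : Walk g) (s : ℤ) : -s ≤ g s := by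
  obtain ⟨N, _, h1⟩ := h.bd
  have := h.mono (min_le_left s (-N))
  simp only [h1 _ (min_le_right s (-N))] at this
  omega

lemma X_finite {e f y : ℤ} (he : e = y + f) (hy : 1 ≤ y) (hf : 1 ≤ f) {g : ℤ → ℤ} (h : Walk g)
    (S r : ℤ) : (X e f g S r).Finite := by
  apply (Set.finite_Icc (-(|r| + |S|)) (|r|)).subset
  intro k hk
  simp only [X, Set.mem_ofPred_eq] at hk
  have h1 := h.nonneg (S + k * e)
  have h2 := h.neg_le (S + k * e)
  have a1 := le_abs_self r
  have a2 := le_abs_self S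
  have a3 := abs_nonneg r
  have a4 := abs_nonneg S
  subst he
  constructor
  · by_contra hc
    push Not at hc
    nlinarith
  · by_contra hc
    push Not at hc
    nlinarith

lemma dom {e f y : ℤ} (he : e = y + f) (hy : 1 ≤ y) (hf : 1 ≤ f) {q m : ℤ → ℤ}
    (hq : Walk q) (hm : Walk m) (hT : TEq e f m q) (hR : WReg e f q) :
    ∀ S r, (X e f m S r ∩ Set.Iic 0).ncard ≤ (X e f q S r ∩ Set.Iic 0).ncard := by
  obtain ⟨N1, _, b1⟩ := hq.bd
  obtain ⟨N2, _, b2⟩ := hm.bd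
  have base : ∀ S, S ≤ min (-N1) (-N2) → ∀ r, 
      (X e f m S r ∩ Set.Iic 0).ncard ≤ (X e f q S r ∩ Set.Iic 0).ncard := by
    intro S hS r
    apply le_of_eq
    congr 1
    ext k
    simp only [X, Set.mem_inter_iff, Set.mem_ofPred_eq, Set.mem_Iic]
    refine and_congr_left fun hk => ?_
    have : S + k * e ≤ S := by nlinarith
    rw [b1 _ (by omega), b2 _ (by omega)]
  have sub1 : ∀ {g : ℤ → ℤ}, Walk g → ∀ S r, X e f g S r ⊆ X e f g (S+1) r := by
    intro g hg S r k hk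
    simp only [X, Set.mem_ofPred_eq] at *
    have := hg.step (S + k * e)
    rw [show S + 1 + k * e = S + k * e + 1 by ring]
    omega
  have sub2 : ∀ {g : ℤ → ℤ}, Walk g → ∀ S r, X e f g (S+1) r ⊆ X e f g S (r+1) := by
    intro g hg S r k hk
    simp only [X, Set.mem_ofPred_eq] at *
    have := hg.step (S + k * e)
    rw [show S + 1 + k * e = S + k * e + 1 by ring] at hk
    omega
  have fin : ∀ {g : ℤ → ℤ}, Walk g → ∀ S r, (X e f g S r).Finite := fun hg S r =>
    X_finite he hy hf hg S r
  have split : ∀ {g : ℤ → ℤ}, Walk g → ∀ S r, (X e f g (S+1) r ∩ Set.Iic 0).ncard =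
      (X e f g S r ∩ Set.Iic 0).ncard + ((X e f g (S+1) r \ X e f g S r) ∩ Set.Iic 0).ncard := by
    intro g hg S r
    rw [← Set.ncard_union_eq ?_ ((fin hg _ _).inter_of_left _) ((fin hg _ _).sdiff.inter_of_left _)]
    · congr 1
      ext k
      have := @sub1 g hg S r k
      simp only [Set.mem_inter_iff, Set.mem_union, Set.mem_sdiff]
      tauto
    · rw [Set.disjoint_left]
      intro k h1 h2
      exact h2.1.2 h1.1
  intro S
  rcases le_total S (min (-N1) (-N2)) with h | h
  · exact base S h
  induction S, h using Int.le_induction with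
  | base => exact base _ le_rfl
  | succ S _ ih =>
    intro r
    by_cases hc : X e f q S (r+1) ∩ Set.Iic 0 ⊆ X e f q (S+1) r
    · calc _ ≤ (X e f m S (r+1) ∩ Set.Iic 0).ncard :=
            Set.ncard_le_ncard (Set.inter_subset_inter_left _ (sub2 hm S r))
              ((fin hm _ _).inter_of_left _)
        _ ≤ _ := ih (r+1)
        _ ≤ _ := Set.ncard_le_ncard (Set.subset_inter hc Set.inter_subset_right)
              ((fin hq _ _).inter_of_left _)
    · have key : X e f q (S+1) r \ X e f q S r ⊆ Set.Iic 0 := by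
        rw [Set.not_subset] at hc
        obtain ⟨k0, ⟨h0, h0'⟩, h1⟩ := hc
        rintro k1 ⟨h2, h3⟩
        simp only [X, Set.mem_ofPred_eq, Set.mem_Iic] at *
        by_contra hk
        rw [show S + 1 + k0 * e = S + k0 * e + 1 by ring] at h1
        rw [show S + 1 + k1 * e = S + k1 * e + 1 by ring] at h2
        have s0 := hq.step (S + k0 * e)
        have s1 := hq.step (S + k1 * e)
        have := hR (S + k0 * e) (k1 - k0) (by omega)
        rw [show S + k0 * e + (k1 - k0) * e = S + k1 * e by ring, sub_mul] at this
        have := this (by omega) (by omega)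
        omega
      have e1 := Set.ncard_sdiff_add_ncard_of_subset (sub1 hq S r) (fin hq _ _)
      have e2 := Set.ncard_sdiff_add_ncard_of_subset (sub1 hm S r) (fin hm _ _)
      have e3 := hT S r
      have e4 := hT (S+1) r
      have e5 : ((X e f m (S+1) r \ X e f m S r) ∩ Set.Iic 0).ncard ≤ _ :=
        Set.ncard_le_ncard Set.inter_subset_left ((fin hm (S+1) r).sdiff)
      have e6 : ((X e f q (S+1) r \ X e f q S r) ∩ Set.Iic 0) = _ := Set.inter_eq_left.2 key
      rw [split hm, split hq, e6]
      have := ih r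
      omega

lemma swap {e f y : ℤ} (he : e = y + f) (hy : 1 ≤ y) (hf : 1 ≤ f) {g : ℤ → ℤ}
    (hg : Walk g) (hR : ¬ WReg e f g) :
    ∃ g', Walk g' ∧ TEq e f g g' ∧ ∃ s t, 1 ≤ t ∧ g (s+1) = g s ∧ g (s + t * e + 1) ≠ g (s + t * e) ∧
      (∀ x ≤ s, g' x = g x) ∧ g' (s+1) < g (s+1) := by
  unfold WReg at hR
  push Not at hR
  obtain ⟨s, t, ht, hl, hr, hu⟩ := hR
  obtain ⟨L, hL⟩ : ∃ L, L = t * e := ⟨_, rfl⟩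
  have hL2 : 2 ≤ L := by nlinarith
  have hu' : g (s + L + 1) = g (s + L) - 1 := by
    rw [hL]
    rcases hg.step (s + t * e) with h | h
    · exact absurd h hu
    · exact h
  have hl' : g (s + L) = g s - t * f := by rw [hL]; exact hl
  obtain ⟨ℓ, hℓ⟩ : ∃ ℓ : ℤ → ℤ, ∀ j, ℓ j = g (s + j % L) - t * f * (j / L) := ⟨_, fun _ => rfl⟩
  have lstep : ∀ j, ℓ (j+1) = ℓ j ∨ ℓ (j+1) = ℓ j - 1 := by
    intro j
    rw [hℓ, hℓ]
    have a1 := Int.emod_nonneg j (show L ≠ 0 by omega)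
    have a2 := Int.emod_lt_of_pos j (show 0 < L by omega)
    have a3 := Int.emod_add_mul_ediv j L
    have hst := hg.step (s + j % L)
    by_cases hw : j % L + 1 = L
    · have b1 : (j+1) / L = j / L + 1 := by
        rw [show j + 1 = L * (j / L + 1) by linarith]
        exact Int.mul_ediv_cancel_left _ (by omega)
      have b2 : (j+1) % L = 0 := by
        rw [show j + 1 = L * (j / L + 1) by linarith]
        exact Int.mul_emod_right _ _
      rw [b1, b2]
      rw [add_assoc, hw, hl'] at hst
      rw [add_zero, mul_add]
      omega
    · have hb : (j+1) / L = j / L ∧ (j+1) % L = j % L + 1 := by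
        rw [Int.ediv_emod_unique (by omega)]
        refine ⟨by linarith, by omega, by omega⟩
      rw [hb.1, hb.2, ← add_assoc]
      omega
  have lper : ∀ j, ℓ (j + L) = ℓ j - t * f := by
    intro j
    rw [hℓ, hℓ, Int.add_emod_right, Int.add_ediv_of_dvd_right (dvd_refl L), Int.ediv_self (by omega)]
    ring
  have l0 : ℓ 0 = g s := by rw [hℓ]; simp
  have l1 : ℓ 1 = g s := by
    rw [hℓ, Int.emod_eq_of_lt (by omega) (by omega), Int.ediv_eq_zero_of_lt (by omega) (by omega), hr]
    simp
  -- find k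
  obtain ⟨k, hk1, hk⟩ : ∃ k : ℤ, 1 ≤ k ∧ g (s + L + k) + t * f = ℓ k := by
    by_contra hcon
    push Not at hcon
    have neg : ∀ j : ℤ, 1 ≤ j → g (s + L + j) + t * f < ℓ j := by
      intro j hj
      induction j, hj using Int.le_induction with
      | base => rw [l1]; omega
      | succ j hj ih =>
        have c1 := hcon (j+1) (by omega)
        have c2 := lstep j
        have c3 := hg.step (s + L + j)
        rw [← add_assoc] at *
        omega
    have lin : ∀ n : ℕ, ℓ (n * L) = g s - n * (t * f) := by
      intro n
      rw [hℓ]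
      simp [Int.mul_ediv_cancel _ (show L ≠ 0 by omega)]
      ring
    have c1 := neg ((((g s).toNat + 1 : ℕ) : ℤ) * L) (by push_cast; nlinarith [Int.self_le_toNat (g s)])
    rw [lin] at c1
    have c2 := hg.nonneg (s + L + (((g s).toNat + 1 : ℕ) : ℤ) * L)
    have c3 := hg.nonneg s
    have c4 : ((g s).toNat : ℤ) = g s := Int.toNat_of_nonneg c3
    push_cast at c1 c2
    rw [c4] at c1 c2
    have : 1 ≤ t * f := by nlinarith
    nlinarith
  obtain ⟨g', hg'⟩ : ∃ g' : ℤ → ℤ, ∀ x, g' x = if x ≤ s then g x else if x ≤ s + k then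
      g (x + L) + t * f else if x ≤ s + k + L then ℓ (x - s) else g x := ⟨_, fun _ => rfl⟩
  have v1 : ∀ x, x ≤ s → g' x = g x := fun x hx => by rw [hg', if_pos hx]
  have v2 : ∀ x, s ≤ x → x ≤ s + k → g' x = g (x + L) + t * f := by
    intro x h1 h2
    rcases eq_or_lt_of_le h1 with h | h
    · rw [v1 x (by omega), ← h, hl']; ring
    · rw [hg', if_neg (by omega), if_pos h2]
  have v3 : ∀ x, s + k ≤ x → x ≤ s + k + L → g' x = ℓ (x - s) := by
    intro x h1 h2
    rcases eq_or_lt_of_le h1 with h | h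
    · rw [v2 x (by omega) (by omega), ← h, show s + k - s = k by ring, ← hk]
      congr 2; ring
    · rw [hg', if_neg (by omega), if_neg (by omega), if_pos h2]
  have v4 : ∀ x, s + k + L ≤ x → g' x = g x := by
    intro x h1
    rcases eq_or_lt_of_le h1 with h | h
    · rw [v3 x (by omega) (by omega), ← h, show s + k + L - s = k + L by ring, lper, ← hk,
        show s + L + k = s + k + L by ring]
      ring
    · rw [hg', if_neg (by omega), if_neg (by omega), if_neg (by omega)]
  have wg' : Walk g' := by
    constructor
    · intro x
      rcases lt_or_ge x s with h | h
      · rw [v1 x (by omega), v1 (x+1) (by omega)]; exact hg.step x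
      rcases lt_or_ge x (s+k) with h2 | h2
      · rw [v2 x (by omega) (by omega), v2 (x+1) (by omega) (by omega)]
        have := hg.step (x + L)
        rw [show x + 1 + L = x + L + 1 by ring]; omega
      rcases lt_or_ge x (s+k+L) with h3 | h3
      · rw [v3 x (by omega) (by omega), v3 (x+1) (by omega) (by omega)]
        have := lstep (x - s)
        rw [show x + 1 - s = x - s + 1 by ring]; omega
      · rw [v4 x (by omega), v4 (x+1) (by omega)]; exact hg.step x
    · obtain ⟨N, n1, n2⟩ := hg.bd
      refine ⟨|N| + |s| + |s + k + L|, fun x hx => ?_, fun x hx => ?_⟩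
      · have := le_abs_self N
        have := le_abs_self (s+k+L)
        have := abs_nonneg s
        have := abs_nonneg N
        have := abs_nonneg (s+k+L)
        rw [v4 x (by omega), n1 x (by omega)]
      · have := le_abs_self N
        have := neg_abs_le s
        have := abs_nonneg (s+k+L)
        have := abs_nonneg N
        have := abs_nonneg s
        rw [v1 x (by omega), n2 x (by omega)]
  -- time shift
  obtain ⟨τ, hτ⟩ : ∃ τ : ℤ → ℤ, ∀ x, τ x = if x < s then 0 else if x < s + k then t else
      if x < s + k + L then - (t * ((x - s) / L)) else 0 := ⟨_, fun _ => rfl⟩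
  have t1 : ∀ x, x < s → τ x = 0 := fun x hx => by rw [hτ, if_pos hx]
  have t2 : ∀ x, s ≤ x → x < s + k → τ x = t := fun x h1 h2 => by
    rw [hτ, if_neg (by omega), if_pos h2]
  have t3 : ∀ x, s + k ≤ x → x < s + k + L → τ x = - (t * ((x - s) / L)) := fun x h1 h2 => by
    rw [hτ, if_neg (by omega), if_neg (by omega), if_pos h2]
  have t4 : ∀ x, s + k + L ≤ x → τ x = 0 := fun x h1 => by
    rw [hτ, if_neg (by omega), if_neg (by omega), if_neg (by omega)]
  have u2 : ∀ x, s ≤ x → x < s + k → x + τ x * e = x + L := fun x h1 h2 => by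
    rw [t2 x h1 h2, hL]
  have u3 : ∀ x, s + k ≤ x → x < s + k + L → x + τ x * e = s + (x - s) % L := fun x h1 h2 => by
    rw [t3 x h1 h2, Int.emod_def]
    rw [hL]; ring
  have m0 : ∀ x, 0 ≤ x % L := fun x => Int.emod_nonneg x (show L ≠ 0 by omega)
  have m1 : ∀ x, x % L < L := fun x => Int.emod_lt_of_pos x (show 0 < L by omega)
  have val : ∀ x, g' x = g (x + τ x * e) + τ x * f := by
    intro x
    rcases lt_or_ge x s with h | h
    · rw [v1 x (by omega), t1 x h]; simp
    rcases lt_or_ge x (s+k) with h2 | h2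
    · rw [u2 x h h2, v2 x h h2.le, t2 x h h2]
    rcases lt_or_ge x (s+k+L) with h3 | h3
    · rw [u3 x h2 h3, v3 x h2 h3.le, t3 x h2 h3, hℓ]; ring
    · rw [v4 x h3, t4 x h3]; simp
  have inj : ∀ x x', x + τ x * e = x' + τ x' * e → x = x' := by
    have cls : ∀ x, (x + τ x * e = x ∧ (x < s ∨ s + k + L ≤ x)) ∨ (s ≤ x ∧ x < s+k ∧ x + τ x * e = x + L) ∨
        (s + k ≤ x ∧ x < s+k+L ∧ x + τ x * e = s + (x-s) % L) := by
      intro x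
      rcases lt_or_ge x s with h | h
      · left; rw [t1 x h]; simp [h]
      rcases lt_or_ge x (s+k) with h2 | h2
      · right; left; exact ⟨h, h2, u2 x h h2⟩
      rcases lt_or_ge x (s+k+L) with h3 | h3
      · right; right; exact ⟨h2, h3, u3 x h2 h3⟩
      · left; rw [t4 x h3]; simp [h3]
    intro x x' hx
    have p1 := m0 (x - s)
    have p2 := m1 (x - s)
    have p3 := m0 (x' - s)
    have p4 := m1 (x' - s)
    rcases cls x with h | h | h <;> rcases cls x' with h' | h' | h'
    · omega
    · omega
    · omega
    · omega
    · omega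
    · omega
    · omega
    · omega
    · have hm : (x - s) % L = (x' - s) % L := by omega
      have hd := Int.ModEq.dvd (n := L) hm
      obtain ⟨c, hc⟩ := hd
      have : c = 0 := by
        have q1 : L * c < L := by omega
        have q2 : -L < L * c := by omega
        have q3 : c < 1 := by nlinarith
        have q4 : -1 < c := by nlinarith
        omega
      rw [this] at hc
      omega
  have surj : ∀ z, ∃ x, x + τ x * e = z := by
    intro z
    rcases lt_or_ge z s with h | h
    · exact ⟨z, by rw [t1 z h]; ring⟩
    rcases lt_or_ge z (s+L) with h2 | h2
    · have p1 := m0 (z - s - k)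
      have p2 := m1 (z - s - k)
      refine ⟨s + k + (z - s - k) % L, ?_⟩
      rw [u3 _ (by omega) (by omega)]
      rw [show s + k + (z - s - k) % L - s = k + (z - s - k) % L by ring, Int.add_emod_emod,
        show k + (z - s - k) = z - s by ring, Int.emod_eq_of_lt (by omega) (by omega)]
      ring
    rcases lt_or_ge z (s+k+L) with h3 | h3
    · exact ⟨z - L, by rw [u2 _ (by omega) (by omega)]; ring⟩
    · exact ⟨z, by rw [t4 z h3]; ring⟩
  refine ⟨g', wg', ?_, s, t, ht, hr, hu, v1, ?_⟩
  · intro S r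
    symm
    refine Set.ncard_congr (fun κ _ => κ + τ (S + κ * e)) ?_ ?_ ?_
    · intro κ h
      simp only [X, Set.mem_ofPred_eq] at *
      rw [val] at h
      rw [show S + (κ + τ (S + κ * e)) * e = S + κ * e + τ (S + κ * e) * e by ring, add_mul]
      omega
    · intro a b _ _ hab
      have := inj (S + a * e) (S + b * e) (by
        have : (a + τ (S + a * e)) * e = (b + τ (S + b * e)) * e := by rw [hab]
        linarith)
      have h3 : a * e = b * e := by omega
      exact mul_right_cancel₀ (by omega) h3
    · intro b hb
      obtain ⟨x, hx⟩ := surj (S + b * e)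
      have hx2 : x = S + (b - τ x) * e := by linarith
      refine ⟨b - τ x, ?_, ?_⟩
      · simp only [X, Set.mem_ofPred_eq] at *
        rw [← hx2, val, hx, sub_mul]
        omega
      · rw [← hx2]; ring
  · rw [v2 _ (by omega) (by omega), hr, show s + 1 + L = s + L + 1 by ring]
    omega

lemma le_ncard_iff (P : ℕ → Prop) (hd : ∀ r, 1 ≤ r → P (r+1) → P r) (N : ℕ)
    (hN : ∀ r, N ≤ r → ¬ P r) (r : ℕ) (hr : 1 ≤ r) : r ≤ {r | 1 ≤ r ∧ P r}.ncard ↔ P r := by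
  classical
  have hex : ∃ K, ¬ P (K+1) := ⟨N, hN _ (by omega)⟩
  obtain ⟨K, hK, hmin⟩ : ∃ K, ¬ P (K+1) ∧ ∀ j < K, P (j+1) :=
    ⟨Nat.find hex, Nat.find_spec hex, fun j hj => by
      have := Nat.find_min hex hj
      exact not_not.1 this⟩
  have above : ∀ j, ¬ P (K + 1 + j) := by
    intro j
    induction j with
    | zero => exact hK
    | succ j ih => exact fun h => ih (hd _ (by omega) h)
  have key : ∀ j, 1 ≤ j → (P j ↔ j ≤ K) := by
    intro j hj
    constructor
    · intro h
      by_contra hc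
      apply above (j - (K+1))
      rwa [show K + 1 + (j - (K+1)) = j by omega]
    · intro h
      have := hmin (j-1) (by omega)
      rwa [show j - 1 + 1 = j by omega] at this
  have hs : {r | 1 ≤ r ∧ P r} = ((Finset.Icc 1 K : Finset ℕ) : Set ℕ) := by
    ext j
    simp only [Set.mem_ofPred_eq, Finset.coe_Icc, Set.mem_Icc]
    constructor
    · rintro ⟨h1, h2⟩; exact ⟨h1, (key j h1).1 h2⟩
    · rintro ⟨h1, h2⟩; exact ⟨h1, (key j h1).2 h2⟩
  rw [hs, Set.ncard_coe_finset, key r hr]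
  simp

noncomputable def G (p : ℕ → ℕ) (s : ℤ) : ℤ := ({r : ℕ | 1 ≤ r ∧ (r:ℤ) + s ≤ p r}.ncard : ℤ)

lemma G_nonneg (p : ℕ → ℕ) (s : ℤ) : 0 ≤ G p s := Int.natCast_nonneg _

lemma G_spec {p : ℕ → ℕ} (hp : IsPartition p) (s : ℤ) (r : ℕ) (hr : 1 ≤ r) :
    (r:ℤ) ≤ G p s ↔ (r:ℤ) + s ≤ p r := by
  obtain ⟨N, hN⟩ := hp.2.2
  rw [G, Nat.cast_le]
  refine le_ncard_iff (fun r : ℕ => (r:ℤ) + s ≤ p r) ?_ (N + s.natAbs + 1) ?_ r hr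
  · intro r hr h
    have := hp.2.1 r hr
    push_cast at h
    omega
  · intro r h
    rw [hN r (by omega)]
    omega

lemma G_spec' {p : ℕ → ℕ} (hp : IsPartition p) (s : ℤ) (r : ℤ) (hr : 1 ≤ r) :
    r ≤ G p s ↔ r + s ≤ p r.toNat := by
  have := G_spec hp s r.toNat (by omega)
  rwa [Int.toNat_of_nonneg (by omega)] at this

lemma part_anti {p : ℕ → ℕ} (hp : IsPartition p) {a b : ℕ} (ha : 1 ≤ a) (hab : a ≤ b) : p b ≤ p a := by
  induction b, hab using Nat.le_induction with
  | base => exact le_rfl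
  | succ b hb ih => exact (hp.2.1 b (by omega)).trans ih

lemma G_bd {p : ℕ → ℕ} (hp : IsPartition p) (n : ℕ) (h1 : ∀ r, p r ≤ n) (h2 : ∀ r, n < r → p r = 0) :
    (∀ s, (n:ℤ) ≤ s → G p s = 0) ∧ (∀ s, s ≤ -(n:ℤ) → G p s = -s) := by
  constructor
  · intro s hs
    by_contra hc
    have := G_nonneg p s
    have h := (G_spec hp s 1 le_rfl).1 (by push_cast; omega)
    have := h1 1
    push_cast at h
    omega
  · intro s hs
    have h0 := G_nonneg p s
    apply le_antisymm
    · by_contra hc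
      have h := (G_spec' hp s (-s+1) (by omega)).1 (by omega)
      rw [h2 _ (by omega)] at h
      push_cast at h
      omega
    · by_cases hz : s = 0
      · omega
      · rw [G_spec' hp s (-s) (by omega)]
        omega

lemma G_walk {p : ℕ → ℕ} (hp : IsPartition p) : Walk (G p) := by
  constructor
  · intro s
    have a0 := G_nonneg p s
    have b0 := G_nonneg p (s+1)
    have c1 : G p (s+1) ≤ G p s := by
      by_cases hb : 1 ≤ G p (s+1)
      · rw [G_spec' hp s _ hb]
        have := (G_spec' hp (s+1) _ hb).1 le_rfl
        omega
      · omega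
    have c2 : G p s - 1 ≤ G p (s+1) := by
      by_cases hb : 1 ≤ G p s - 1
      · rw [G_spec' hp (s+1) _ hb]
        have := (G_spec' hp s (G p s) (by omega)).1 le_rfl
        have h3 := part_anti hp (a := (G p s - 1).toNat) (b := (G p s).toNat) (by omega) (by omega)
        omega
      · omega
    omega
  · obtain ⟨N, hN⟩ := hp.2.2
    refine ⟨((N + p 1 : ℕ) : ℤ), G_bd hp (N + p 1) (fun r => ?_) (fun r hr => hN r (by omega))⟩
    rcases Nat.eq_zero_or_pos r with h | h
    · rw [h, hp.1]; omega
    · have := part_anti hp le_rfl h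
      omega

lemma G_surj {g : ℤ → ℤ} (hg : Walk g) : ∃ p, IsPartition p ∧ G p = g := by
  classical
  obtain ⟨N, n1, n2⟩ := hg.bd
  obtain ⟨p, hp0⟩ : ∃ p : ℕ → ℕ, ∀ r, p r = if r = 0 then 0 else
      {c : ℕ | 1 ≤ c ∧ (r:ℤ) ≤ g ((c:ℤ) - r)}.ncard := ⟨_, fun _ => rfl⟩
  have spec : ∀ r c : ℕ, 1 ≤ r → 1 ≤ c → (c ≤ p r ↔ (r:ℤ) ≤ g ((c:ℤ) - r)) := by
    intro r c hr hc
    rw [hp0, if_neg (by omega)]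
    refine le_ncard_iff (fun c : ℕ => (r:ℤ) ≤ g ((c:ℤ) - r)) ?_ (r + N.natAbs) ?_ c hc
    · intro c _ h
      have := hg.anti (show (c:ℤ) - r ≤ ((c+1:ℕ):ℤ) - r by push_cast; omega)
      exact h.trans this
    · intro c hc
      rw [n1 _ (by omega)]
      omega
  have hp : IsPartition p := by
    refine ⟨by rw [hp0]; simp, ?_, N.natAbs + 1, ?_⟩
    · intro r hr
      rcases Nat.eq_zero_or_pos (p (r+1)) with h | h
      · omega
      rw [spec r _ hr h]
      have := (spec (r+1) _ (by omega) h).1 le_rfl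
      have h2 := hg.step ((p (r+1) : ℤ) - ((r+1 : ℕ):ℤ))
      rw [show (p (r+1) : ℤ) - ((r+1 : ℕ):ℤ) + 1 = p (r+1) - r by push_cast; ring] at h2
      push_cast at *
      omega
    · intro r hr
      by_contra hc
      have := (spec r 1 (by omega) le_rfl).1 (by omega)
      rw [n2 _ (by push_cast; omega)] at this
      push_cast at this
      omega
  refine ⟨p, hp, ?_⟩
  have iff : ∀ s r : ℤ, 1 ≤ r → (r ≤ G p s ↔ r ≤ g s) := by
    intro s r hr
    rw [G_spec' hp s r hr]
    by_cases h : r + s ≤ 0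
    · have := hg.neg_le s
      constructor
      · intro; omega
      · intro; omega
    · have := spec r.toNat (r+s).toNat (by omega) (by omega)
      rw [Int.toNat_of_nonneg (by omega), Int.toNat_of_nonneg (by omega), show r + s - r = s by ring] at this
      rw [← this]
      omega
  funext s
  have a0 := G_nonneg p s
  have b0 := hg.nonneg s
  apply le_antisymm
  · by_cases h : 1 ≤ G p s
    · exact (iff s _ h).1 le_rfl
    · omega
  · by_cases h : 1 ≤ g s
    · exact (iff s _ h).2 le_rfl
    · omega

lemma conj_spec {p : ℕ → ℕ} (hp : IsPartition p) (c r : ℕ) (hc : 1 ≤ c) (hr : 1 ≤ r) :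
    r ≤ conj p c ↔ c ≤ p r := by
  obtain ⟨N, hN⟩ := hp.2.2
  refine le_ncard_iff (fun r : ℕ => c ≤ p r) ?_ N ?_ r hr
  · intro r hr h
    exact h.trans (hp.2.1 r hr)
  · intro r h
    rw [hN r h]
    omega

lemma reg_iff {e f y : ℕ} (he : e = y + f) (hy : 1 ≤ y) {p : ℕ → ℕ} (hp : IsPartition p) :
    EYRegular e y p ↔ WReg (e:ℤ) (f:ℤ) (G p) := by
  have hw := G_walk hp
  constructor
  · intro h s t ht h1 h2
    by_contra h3
    have h4 := (hw.step (s + t * e)).resolve_left h3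
    obtain ⟨t, rfl⟩ := Int.eq_ofNat_of_zero_le (show 0 ≤ t by omega)
    have n1 := G_nonneg p (s + t * e + 1)
    have n2 := G_nonneg p s
    obtain ⟨R, hR⟩ := Int.eq_ofNat_of_zero_le n2
    obtain ⟨r, hr⟩ := Int.eq_ofNat_of_zero_le (G_nonneg p (s + t * e))
    have hr1 : 1 ≤ r := by omega
    have e1 : (R:ℤ) = r + t * f := by omega
    have e1' : R = r + t * f := by exact_mod_cast e1
    have hR1 : 1 ≤ R := by omega
    have q1 := (G_spec hp (s + t * e) r hr1).1 (by omega)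
    have q2 := (not_congr (G_spec hp (s + t * e + 1) r hr1)).1 (by omega)
    have q3 := (G_spec hp (s + 1) R hR1).1 (by omega)
    have q4 := (not_congr (G_spec hp s (R+1) (by omega))).1 (by push_cast; omega)
    push_cast at q4
    obtain ⟨c, hc⟩ := Int.eq_ofNat_of_zero_le (show 0 ≤ s + 1 + R by omega)
    have hc1 : 1 ≤ c := by omega
    have j1 := (conj_spec hp c R hc1 hR1).2 (by omega)
    have j2 := (not_congr (conj_spec hp c (R+1) hc1 (by omega))).2 (by omega)
    have pe : (p r : ℤ) + 1 = c + y * t := by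
      have : (t:ℤ) * e = t * y + t * f := by rw [he]; push_cast; ring
      have : (y:ℤ) * t = t * y := by ring
      omega
    have pe' : p r + 1 = c + y * t := by exact_mod_cast pe
    have ht' : 1 ≤ t := by omega
    have yt : 1 ≤ y * t := Nat.mul_pos hy ht'
    have et : e * t = y * t + t * f := by rw [he]; ring
    exact h t ht' ⟨r, c, hr1, hc1, by omega, by omega, by omega⟩
  · rintro h t ht ⟨r, c, hr, hc, hcr, hlen, harm⟩
    have yt : 1 ≤ y * t := Nat.mul_pos hy ht
    have et : e * t = y * t + t * f := by rw [he]; ring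
    have j0 := (conj_spec hp c r hc hr).2 hcr
    obtain ⟨R, hR⟩ : ∃ R, R = conj p c := ⟨_, rfl⟩
    rw [← hR] at j0 hlen
    have hRr : R = r + t * f := by omega
    have j1 := (conj_spec hp c R hc (by omega)).1 (by omega)
    have j2 := (not_congr (conj_spec hp c (R+1) hc (by omega))).1 (by omega)
    have etz : (t:ℤ) * e = y * t + t * f := by rw [he]; push_cast; ring
    have hRz : (R:ℤ) = r + t * f := by exact_mod_cast hRr
    have pe : (p r : ℤ) + 1 = c + y * t := by
      have : p r + 1 = c + y * t := by omega
      exact_mod_cast this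
    have dec := hp.2.1 r hr
    have g1 := (G_spec hp ((c:ℤ) - 1 - R + 1) R (by omega)).2 (by omega)
    have g2 := (not_congr (G_spec hp ((c:ℤ) - 1 - R) (R+1) (by omega))).2 (by push_cast; omega)
    have g3 := (G_spec hp ((c:ℤ) - 1 - R + t * e) r (by omega)).2 (by omega)
    have g4 := (not_congr (G_spec hp ((c:ℤ) - 1 - R + t * e) (r+1) (by omega))).2 (by push_cast; omega)
    have g5 := (not_congr (G_spec hp ((c:ℤ) - 1 - R + t * e + 1) r (by omega))).2 (by omega)
    have st := hw.step ((c:ℤ) - 1 - R)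
    push_cast at g2 g4
    have := h ((c:ℤ) - 1 - R) t (by omega) (by omega) (by omega)
    omega

lemma mem_cells {p : ℕ → ℕ} (hp : IsPartition p) (a b : ℤ) :
    (a, b) ∈ cells p ↔ 1 ≤ a ∧ 1 ≤ b ∧ a ≤ G p (b - a) := by
  simp only [cells, Set.mem_ofPred_eq]
  refine and_congr_right fun ha => and_congr_right fun _ => ?_
  rw [G_spec' hp _ _ ha, show a + (b - a) = b by ring]

def V (f y r c : ℤ) : Set ℤ := {k | 1 ≤ r - k * f ∧ 1 ≤ c + k * y}

lemma V_finite {f y : ℤ} (hy : 1 ≤ y) (hf : 1 ≤ f) (r c : ℤ) : (V f y r c).Finite := by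
  apply (Set.finite_Icc (-|c|) (|r|)).subset
  rintro k ⟨h1, h2⟩
  have a1 := le_abs_self r
  have a2 := le_abs_self c
  have a3 := abs_nonneg r
  have a4 := abs_nonneg c
  constructor
  · by_contra hc
    push Not at hc
    nlinarith
  · by_contra hc
    push Not at hc
    nlinarith

lemma count {e f y : ℤ} (he : e = y + f) (hy : 1 ≤ y) (hf : 1 ≤ f) {p : ℕ → ℕ} (hp : IsPartition p)
    (r c : ℤ) (W : Set ℤ) :
    (Ladder e y r c ∩ cells p ∩ {x | x.1 ∈ W}).ncard +
      (X e f (G p) (c - r) r ∩ {k | r - k * f ∈ W}).ncard = (V f y r c ∩ {k | r - k * f ∈ W}).ncard := by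
  have hw := G_walk hp
  have him : Ladder e y r c ∩ cells p ∩ {x | x.1 ∈ W} =
      (fun k : ℤ => (r - k * f, c + k * y)) '' ((V f y r c \ X e f (G p) (c-r) r) ∩ {k | r - k * f ∈ W}) := by
    have hyf : y - e = -f := by omega
    have mc : ∀ k : ℤ, (r - k * f, c + k * y) ∈ cells p ↔ k ∈ V f y r c \ X e f (G p) (c-r) r := by
      intro k
      rw [mem_cells hp]
      simp only [V, X, Set.mem_sdiff, Set.mem_ofPred_eq, not_lt, and_assoc]
      rw [show c + k * y - (r - k * f) = c - r + k * e by rw [he]; ring]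
    ext x
    simp only [Set.mem_image]
    constructor
    · rintro ⟨⟨⟨k, hk⟩, h2⟩, h3⟩
      have hk' : x = (r - k * f, c + k * y) := by rw [hk, hyf]; ring_nf
      refine ⟨k, ⟨(mc k).1 (hk' ▸ h2), ?_⟩, hk'.symm⟩
      rw [hk'] at h3
      exact h3
    · rintro ⟨k, ⟨h1, h2⟩, rfl⟩
      refine ⟨⟨⟨k, ?_⟩, (mc k).2 h1⟩, h2⟩
      rw [hyf]; ring_nf
  rw [him, Set.ncard_image_of_injective]
  · rw [← Set.ncard_union_eq ?_ ((V_finite hy hf r c).sdiff.inter_of_left _)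
      ((X_finite he hy hf hw _ _).inter_of_left _)]
    · congr 1
      ext k
      have : k ∈ X e f (G p) (c-r) r → k ∈ V f y r c := by
        intro h
        simp only [X, V, Set.mem_ofPred_eq] at *
        have h1 := hw.nonneg (c - r + k * e)
        have h2 := hw.neg_le (c - r + k * e)
        have : k * e = k * y + k * f := by rw [he]; ring
        omega
      simp only [Set.mem_inter_iff, Set.mem_union, Set.mem_sdiff]
      tauto
    · rw [Set.disjoint_left]
      intro k h1 h2
      exact h1.1.2 h2.1
  · intro a b hab
    simp only [Prod.mk.injEq] at hab
    have : a * y = b * y := by omega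
    exact mul_right_cancel₀ (by omega) this

lemma equiv_iff {e f y : ℤ} (he : e = y + f) (hy : 1 ≤ y) (hf : 1 ≤ f) {p q : ℕ → ℕ}
    (hp : IsPartition p) (hq : IsPartition q) : LadderEquiv e y p q ↔ TEq e f (G p) (G q) := by
  have cp := fun r c => count he hy hf hp r c Set.univ
  have cq := fun r c => count he hy hf hq r c Set.univ
  simp only [Set.mem_univ, Set.ofPred_true, Set.inter_univ] at cp cq
  constructor
  · intro h S r
    have a := cp r (r + S)
    have b := cq r (r + S)
    have := h r (r+S)
    rw [show r + S - r = S by ring] at a b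
    omega
  · intro h r c
    have a := cp r c
    have b := cq r c
    have := h (c - r) r
    omega

lemma sum_lemma {e y : ℤ} {m q : ℕ → ℕ} (n : ℕ)
    (h : ∀ r c, (Ladder e y r c ∩ cells m ∩ {x | x.1 ≤ (n:ℤ)}).ncard ≤
      (Ladder e y r c ∩ cells q ∩ {x | x.1 ≤ (n:ℤ)}).ncard) :
    ∑ r ∈ Finset.Icc 1 n, m r ≤ ∑ r ∈ Finset.Icc 1 n, q r := by
  classical
  obtain ⟨A, hA⟩ : ∃ A : (ℕ → ℕ) → Finset (ℤ × ℤ), ∀ p, A p =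
      ((Finset.Icc 1 n).sigma (fun r => Finset.Icc 1 (p r))).image
        (fun x => ((x.1 : ℤ), (x.2 : ℤ))) := ⟨_, fun _ => rfl⟩
  have cardA : ∀ p, (A p).card = ∑ r ∈ Finset.Icc 1 n, p r := by
    intro p
    rw [hA, Finset.card_image_of_injective, Finset.card_sigma]
    · simp
    · rintro ⟨a, b⟩ ⟨c, d⟩ h
      simp only [Prod.mk.injEq, Nat.cast_inj] at h
      obtain ⟨rfl, rfl⟩ := h
      rfl
  have memA : ∀ p x, x ∈ A p ↔ x ∈ cells p ∧ x.1 ≤ n := by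
    rintro p ⟨a, b⟩
    rw [hA]
    simp only [Finset.mem_image, Finset.mem_sigma, Finset.mem_Icc, cells, Set.mem_ofPred_eq, Prod.mk.injEq,
      Sigma.exists]
    constructor
    · rintro ⟨i, j, h, rfl, rfl⟩
      simp only [Int.toNat_natCast]
      omega
    · rintro ⟨⟨h1, h2, h3⟩, h4⟩
      exact ⟨a.toNat, b.toNat, by omega, by omega, by omega⟩
  have lad : ∀ x x0 : ℤ × ℤ, Ladder e y x.1 x.2 = Ladder e y x0.1 x0.2 ↔ x ∈ Ladder e y x0.1 x0.2 := by
    intro x x0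
    constructor
    · intro h
      rw [← h]
      exact ⟨0, by simp⟩
    · rintro ⟨k, rfl⟩
      ext z
      constructor
      · rintro ⟨j, rfl⟩
        exact ⟨k + j, by simp only [Prod.mk.injEq]; constructor <;> ring⟩
      · rintro ⟨j, rfl⟩
        exact ⟨j - k, by simp only [Prod.mk.injEq]; constructor <;> ring⟩
  rw [← cardA, ← cardA]
  obtain ⟨φ, hφ⟩ : ∃ φ : ℤ × ℤ → Set (ℤ × ℤ), ∀ x, φ x = Ladder e y x.1 x.2 := ⟨_, fun _ => rfl⟩
  have fib : ∀ p x0, ((A p).filter (fun x => φ x = φ x0)).card =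
      (Ladder e y x0.1 x0.2 ∩ cells p ∩ {x | x.1 ≤ (n:ℤ)}).ncard := by
    intro p x0
    rw [← Set.ncard_coe_finset]
    congr 1
    ext x
    simp only [Finset.coe_filter, Set.mem_ofPred_eq, memA, hφ, lad, Set.mem_inter_iff]
    tauto
  rw [Finset.card_eq_sum_card_fiberwise (f := φ) (t := (A m ∪ A q).image φ) (s := A m),
    Finset.card_eq_sum_card_fiberwise (f := φ) (t := (A m ∪ A q).image φ) (s := A q)]
  · apply Finset.sum_le_sum
    intro b hb
    obtain ⟨x0, _, rfl⟩ := Finset.mem_image.1 hb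
    rw [fib, fib]
    exact h _ _
  · intro x hx
    exact Finset.mem_coe.2 (Finset.mem_image_of_mem _ (Finset.mem_union_right _ hx))
  · intro x hx
    exact Finset.mem_coe.2 (Finset.mem_image_of_mem _ (Finset.mem_union_left _ hx))

lemma psize_eq {p : ℕ → ℕ} (hp : IsPartition p) : ∃ N, (∀ r, N ≤ r → p r = 0) ∧
    ∀ n, N ≤ n → psize p = ∑ r ∈ Finset.Icc 1 n, p r := by
  obtain ⟨N, hN⟩ := hp.2.2
  refine ⟨N, hN, fun n hn => ?_⟩
  refine tsum_eq_sum fun b hb => ?_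
  simp only [Finset.mem_Icc] at hb
  rcases Nat.eq_zero_or_pos b with h | h
  · rw [h, hp.1]
  · exact hN b (by omega)

lemma psize_bd {p : ℕ → ℕ} (hp : IsPartition p) :
    (∀ r, p r ≤ psize p) ∧ (∀ r, psize p < r → p r = 0) := by
  obtain ⟨N, hN, h⟩ := psize_eq hp
  constructor
  · intro r
    rcases Nat.eq_zero_or_pos r with h0 | h0
    · rw [h0, hp.1]; omega
    rw [h (N + r) (by omega)]
    exact Finset.single_le_sum (f := p) (fun _ _ => Nat.zero_le _) (Finset.mem_Icc.2 ⟨h0, by omega⟩)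
  · intro r hr
    by_contra hc
    rw [h (N + r) (by omega)] at hr
    have h1 : ∑ i ∈ Finset.Icc 1 r, 1 ≤ ∑ i ∈ Finset.Icc 1 r, p i := by
      apply Finset.sum_le_sum
      intro i hi
      rw [Finset.mem_Icc] at hi
      have := part_anti hp hi.1 hi.2
      omega
    have h2 : ∑ i ∈ Finset.Icc 1 r, p i ≤ ∑ i ∈ Finset.Icc 1 (N + r), p i :=
      Finset.sum_le_sum_of_subset (Finset.Icc_subset_Icc_right (by omega))
    simp at h1
    omega

lemma psize_le {e y : ℤ} {p q : ℕ → ℕ} (hp : IsPartition p) (hq : IsPartition q)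
    (h : LadderEquiv e y p q) : psize p ≤ psize q := by
  obtain ⟨N, hN, a⟩ := psize_eq hp
  obtain ⟨M, hM, b⟩ := psize_eq hq
  rw [a (N+M) (by omega), b (N+M) (by omega)]
  apply sum_lemma (e := e) (y := y)
  have key : ∀ {p : ℕ → ℕ} {N : ℕ} (M : ℕ), (∀ r, N ≤ r → p r = 0) → N ≤ M → 
      cells p ⊆ {x | x.1 ≤ (M : ℤ)} := by
    intro p N M hN hM x hx
    simp only [cells, Set.mem_ofPred_eq] at *
    by_contra hc
    rw [hN _ (by omega)] at hx
    push_cast at hx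
    omega
  intro r c
  rw [Set.inter_assoc, Set.inter_assoc, Set.inter_eq_left.2 (key _ hN (by omega)),
    Set.inter_eq_left.2 (key _ hM (by omega)), h r c]

lemma dominates {e f y : ℕ} (he : e = y + f) (hy : 1 ≤ y) (hf : 1 ≤ f) {q m : ℕ → ℕ}
    (hq : IsPartition q) (hm : IsPartition m) (h : LadderEquiv (e:ℤ) y m q) (hR : EYRegular e y q) :
    Dominates q m := by
  have hez : (e:ℤ) = y + f := by rw [he]; push_cast; ring
  have hyz : (1:ℤ) ≤ y := by omega
  have hfz : (1:ℤ) ≤ f := by omega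
  refine ⟨le_antisymm (psize_le hq hm fun r c => (h r c).symm) (psize_le hm hq h), fun n => ?_⟩
  have hT := (equiv_iff hez hyz hfz hm hq).1 h
  have hD := dom hez hyz hfz (G_walk hq) (G_walk hm) hT ((reg_iff he hy hq).1 hR)
  apply sum_lemma (e := e) (y := y)
  intro r c
  have c1 := count hez hyz hfz hm r c (Set.Iic (n:ℤ))
  have c2 := count hez hyz hfz hq r c (Set.Iic (n:ℤ))
  obtain ⟨K, hK⟩ : ∃ K, K = (r - n - 1) / (f:ℤ) := ⟨_, rfl⟩
  have hset : {k : ℤ | r - k * f ∈ Set.Iic (n:ℤ)} = (Set.Iic K)ᶜ := by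
    ext k
    simp only [Set.mem_ofPred_eq, Set.mem_Iic, Set.mem_compl_iff]
    rw [hK, Int.le_ediv_iff_mul_le (by omega)]
    omega
  rw [hset] at c1 c2
  have shift : ∀ g : ℤ → ℤ, (X e f g (c-r) r ∩ Set.Iic K).ncard =
      (X e f g (c - r + K * e) (r - K * f) ∩ Set.Iic 0).ncard := by
    intro g
    symm
    have : X e f g (c-r) r ∩ Set.Iic K =
      (fun k => k + K) '' (X e f g (c - r + K * e) (r - K * f) ∩ Set.Iic 0) := by
      ext k
      simp only [Set.image_add_right, Set.mem_preimage, X, Set.mem_inter_iff, Set.mem_ofPred_eq, Set.mem_Iic]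
      rw [show c - r + K * e + (k + -K) * e = c - r + k * e by ring,
        show r - K * f - (k + -K) * f = r - k * f by ring]
      refine and_congr_right fun _ => ?_
      omega
    rw [this, Set.ncard_image_of_injective _ (add_left_injective K)]
  have d := hD (c - r + K * e) (r - K * f)
  rw [← shift, ← shift] at d
  have s1 := Set.ncard_inter_add_ncard_sdiff_eq_ncard (X e f (G q) (c-r) r) (Set.Iic K)
    (X_finite hez hyz hfz (G_walk hq) _ _)
  have s2 := Set.ncard_inter_add_ncard_sdiff_eq_ncard (X e f (G m) (c-r) r) (Set.Iic K)
    (X_finite hez hyz hfz (G_walk hm) _ _)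
  rw [Set.sdiff_eq] at s1 s2
  have ht := hT (c - r) r
  simp only [Set.mem_Iic] at c1 c2
  omega

lemma exists_reg {e f y : ℕ} (he : e = y + f) (hy : 1 ≤ y) (hf : 1 ≤ f) {p : ℕ → ℕ}
    (hp : IsPartition p) : ∃ q, IsPartition q ∧ LadderEquiv (e:ℤ) y p q ∧ EYRegular e y q := by
  have hez : (e:ℤ) = y + f := by rw [he]; push_cast; ring
  have hyz : (1:ℤ) ≤ y := by omega
  have hfz : (1:ℤ) ≤ f := by omega
  obtain ⟨n, hn⟩ : ∃ n, n = psize p := ⟨_, rfl⟩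
  have wf : WellFounded (Pi.Lex (ι := Fin (2*n+1)) (β := fun _ => ℕ) (· < ·) (fun {_} => (· < ·))) :=
    Pi.Lex.wellFounded (· < ·) (fun _ => wellFounded_lt)
  obtain ⟨Φ, hΦ⟩ : ∃ Φ : (ℕ → ℕ) → (Fin (2*n+1) → ℕ), ∀ q i, Φ q i = (G q ((i:ℕ) - (n:ℤ))).toNat :=
    ⟨_, fun _ _ => rfl⟩
  obtain ⟨q, ⟨hq, hpq⟩, hmin⟩ := (InvImage.wf Φ wf).has_min
    {q | IsPartition q ∧ LadderEquiv (e:ℤ) y p q} ⟨p, hp, fun _ _ => rfl⟩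
  refine ⟨q, hq, hpq, ?_⟩
  by_contra hR
  rw [reg_iff he hy hq] at hR
  obtain ⟨g', hg', hT, s, t, ht, h1, h2, h3, h4⟩ := swap hez hyz hfz (G_walk hq) hR
  obtain ⟨q', hq', rfl⟩ := G_surj hg'
  have hqq' := (equiv_iff hez hyz hfz hq hq').2 hT
  have hsz : psize q = n := by
    rw [hn]
    exact le_antisymm (psize_le hq hp fun r c => (hpq r c).symm) (psize_le hp hq hpq)
  obtain ⟨b1, b2⟩ := psize_bd hq
  rw [hsz] at b1 b2
  obtain ⟨d1, d2⟩ := G_bd hq n b1 b2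
  have w1 : -(n:ℤ) ≤ s := by
    by_contra hc
    rw [d2 s (by omega), d2 (s+1) (by omega)] at h1
    omega
  have w2 : s + 1 ≤ n := by
    by_contra hc
    have : 0 < t * e := by nlinarith
    rw [d1 _ (by omega), d1 _ (by omega)] at h2
    exact h2 rfl
  refine hmin q' ⟨hq', fun r c => (hpq r c).trans (hqq' r c)⟩ ?_
  refine ⟨⟨(s + 1 + n).toNat, by omega⟩, ?_, ?_⟩
  · intro j hj
    rw [Fin.lt_def] at hj
    simp only at hj
    rw [hΦ, hΦ, h3 _ (by omega)]
  · rw [hΦ, hΦ]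
    simp only
    rw [show (((s + 1 + n).toNat : ℕ) : ℤ) - n = s + 1 by omega]
    have := G_nonneg q' (s+1)
    omega

lemma dom_antisymm {p q : ℕ → ℕ} (hp : IsPartition p) (hq : IsPartition q) (h1 : Dominates p q)
    (h2 : Dominates q p) : p = q := by
  funext r
  rcases Nat.eq_zero_or_pos r with h | h
  · rw [h, hp.1, hq.1]
  obtain ⟨r, rfl⟩ : ∃ k, r = k + 1 := ⟨r - 1, by omega⟩
  have a := h1.2 r
  have b := h2.2 r
  have c := h1.2 (r+1)
  have d := h2.2 (r+1)
  rw [Finset.sum_Icc_succ_top (by omega), Finset.sum_Icc_succ_top (by omega)] at c d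
  omega

end LR

/-- Each `(e,y)`-ladder class contains a unique `(e,y)`-regular partition, and
this partition dominates every partition in the class. -/
theorem ladder_class_regularisation (e y : ℕ) (he : 2 ≤ e) (hy1 : 1 ≤ y) (hy2 : y ≤ e - 1)
    (p : ℕ → ℕ) (hp : IsPartition p) :
    ∃ q : ℕ → ℕ, (IsPartition q ∧ LadderEquiv (e : ℤ) (y : ℤ) p q ∧ EYRegular e y q) ∧
      (∀ q' : ℕ → ℕ, IsPartition q' → LadderEquiv (e : ℤ) (y : ℤ) p q' → EYRegular e y q' →
        q' = q) ∧
      (∀ m : ℕ → ℕ, IsPartition m → LadderEquiv (e : ℤ) (y : ℤ) p m → Dominates q m) := by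

  obtain ⟨f, hf⟩ : ∃ f, e = y + f := ⟨e - y, by omega⟩
  have hf1 : 1 ≤ f := by omega
  obtain ⟨q, hq, hpq, hR⟩ := LR.exists_reg hf hy1 hf1 hp
  have hdom : ∀ q : ℕ → ℕ, IsPartition q → LadderEquiv (e : ℤ) (y : ℤ) p q → EYRegular e y q →
      ∀ m : ℕ → ℕ, IsPartition m → LadderEquiv (e : ℤ) (y : ℤ) p m → Dominates q m :=
    fun q hq hpq hR m hm hpm =>
      LR.dominates hf hy1 hf1 hq hm (fun r c => (hpm r c).symm.trans (hpq r c)) hR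
  refine ⟨q, ⟨hq, hpq, hR⟩, fun q' hq' hpq' hR' => ?_, hdom q hq hpq hR⟩
  exact LR.dom_antisymm hq' hq (hdom q' hq' hpq' hR' q hq hpq) (hdom q hq hpq hR q' hq' hpq')
end

section
/- Each (e,y)-ladder class of partitions contains a unique (e,y)-restricted partition, and this partition is dominated by every partition in the class. -/
/-- `p` is `(e,y)`-restricted: no hook of length `et` and arm length `yt`. -/
noncomputable def EYRestricted (e y : ℕ) (p : ℕ → ℕ) : Prop :=
  ∀ t : ℕ, 1 ≤ t → ¬ HasHook p (e * t) (y * t)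


def OutC (p : ℕ → ℕ) (r c : ℤ) : Prop := 1 ≤ r ∧ 1 ≤ c ∧ (p r.toNat : ℤ) < c

def SS (a b : ℤ) (p : ℕ → ℕ) (r c : ℤ) : Set ℤ := {k | OutC p (r - k * a) (c + k * b)}

def II (a b : ℤ) (r c : ℤ) : Set ℤ := {k | 1 ≤ r - k * a ∧ 1 ≤ c + k * b}

noncomputable def NN (a b : ℤ) (p : ℕ → ℕ) (r c : ℤ) : ℕ := (SS a b p r c).ncard

def Pos (a b : ℤ) (p : ℕ → ℕ) (t : ℕ) (j : ℤ) : Prop :=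
  ∃ r c : ℤ, c - r = j ∧ OutC p r c ∧ ¬ OutC p (r - t * a) (c + t * b)

def Restr (a b : ℤ) (p : ℕ → ℕ) : Prop :=
  ∀ t : ℕ, 1 ≤ t → ∀ j, Pos a b p t j → Pos a b p t (j + 1)

theorem part_anti {p : ℕ → ℕ} (hp : IsPartition p) {i j : ℕ} (hi : 1 ≤ i) (hij : i ≤ j) :
    p j ≤ p i := by
  induction j, hij using Nat.le_induction with
  | base => exact le_rfl
  | succ n hn ih => exact (hp.2.1 n (by omega)).trans ih

theorem OutC.mono {p : ℕ → ℕ} (hp : IsPartition p) {r c r' c' : ℤ} (h : OutC p r c)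
    (hr : r ≤ r') (hc : c ≤ c') : OutC p r' c' := by
  obtain ⟨h1, h2, h3⟩ := h
  refine ⟨by omega, by omega, ?_⟩
  have := part_anti hp (i := r.toNat) (j := r'.toNat) (by omega) (by omega)
  omega

theorem II_finite {a b : ℤ} (ha : 0 < a) (hb : 0 < b) (r c : ℤ) : (II a b r c).Finite := by
  apply (Set.finite_Icc (-|c|) |r|).subset
  rintro k ⟨h1, h2⟩
  have := le_abs_self r
  have := le_abs_self c
  have := abs_nonneg r
  have := abs_nonneg c
  constructor
  · by_contra h; push Not at h; nlinarith
  · by_contra h; push Not at h; nlinarith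

theorem SS_sub_II {a b : ℤ} (p : ℕ → ℕ) (r c : ℤ) : SS a b p r c ⊆ II a b r c :=
  fun _ h => ⟨h.1, h.2.1⟩

theorem SS_finite {a b : ℤ} (ha : 0 < a) (hb : 0 < b) (p : ℕ → ℕ) (r c : ℤ) :
    (SS a b p r c).Finite := (II_finite ha hb r c).subset (SS_sub_II p r c)

theorem SS_shift {a b : ℤ} (p : ℕ → ℕ) (r c k l : ℤ) :
    l ∈ SS a b p (r - k * a) (c + k * b) ↔ l + k ∈ SS a b p r c := by
  simp only [SS, Set.mem_setOf_eq]
  rw [show r - k * a - l * a = r - (l + k) * a by ring,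
    show c + k * b + l * b = c + (l + k) * b by ring]

theorem II_shift {a b : ℤ} (r c k l : ℤ) :
    l ∈ II a b (r - k * a) (c + k * b) ↔ l + k ∈ II a b r c := by
  simp only [II, Set.mem_setOf_eq]
  rw [show r - k * a - l * a = r - (l + k) * a by ring,
    show c + k * b + l * b = c + (l + k) * b by ring]

theorem ncard_shift {A B : Set ℤ} (k : ℤ) (h : ∀ l, l ∈ A ↔ l + k ∈ B) : A.ncard = B.ncard := by
  have : B = (fun l => l + k) '' A := by
    ext x
    simp only [Set.mem_image]
    constructor
    · intro hx
      exact ⟨x - k, (h _).2 (by simpa using hx), by ring⟩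
    · rintro ⟨l, hl, rfl⟩
      exact (h l).1 hl
  rw [this, Set.ncard_image_of_injective _ (add_left_injective k)]

theorem NN_shift {a b : ℤ} (p : ℕ → ℕ) (r c k : ℤ) :
    NN a b p (r - k * a) (c + k * b) = NN a b p r c :=
  ncard_shift k (SS_shift p r c k)

theorem SS_mono {a b : ℤ} {p : ℕ → ℕ} (hp : IsPartition p) {r c r' c' : ℤ}
    (hr : r ≤ r') (hc : c ≤ c') : SS a b p r c ⊆ SS a b p r' c' :=
  fun _ h => OutC.mono hp h (by linarith) (by linarith)

/-- comparable points with the same count have the same set -/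
theorem SS_eq {a b : ℤ} (ha : 0 < a) (hb : 0 < b) {p : ℕ → ℕ} (hp : IsPartition p) {r c r' c' : ℤ}
    (h : c' - r' = c - r ∨ c' - r' = c - r + 1) (hN : NN a b p r c = NN a b p r' c') :
    SS a b p r c = SS a b p r' c' := by
  by_cases hcc : r ≤ r' ∧ c ≤ c'
  · exact Set.eq_of_subset_of_ncard_le (SS_mono hp hcc.1 hcc.2) hN.ge (SS_finite ha hb _ _ _)
  · exact (Set.eq_of_subset_of_ncard_le (SS_mono hp (by omega) (by omega)) hN.le
      (SS_finite ha hb _ _ _)).symm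

/-! Hooks versus Pos -/

theorem conj_eq {p : ℕ → ℕ} (hp : IsPartition p) {c s : ℕ} (hc : 1 ≤ c)
    (h1 : ∀ r, 1 ≤ r → (c ≤ p r ↔ r ≤ s)) : conj p c = s := by
  unfold conj
  have : {r : ℕ | 1 ≤ r ∧ c ≤ p r} = ↑(Finset.Icc 1 s) := by
    ext r
    simp only [Set.mem_setOf_eq, Finset.coe_Icc, Set.mem_Icc]
    constructor
    · rintro ⟨h, h'⟩; exact ⟨h, (h1 r h).1 h'⟩
    · rintro ⟨h, h'⟩; exact ⟨h, (h1 r h).2 h'⟩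
  rw [this, Set.ncard_coe_finset]; simp

theorem exists_conj {p : ℕ → ℕ} (hp : IsPartition p) {c : ℕ} (hc : 1 ≤ c) :
    ∀ r, 1 ≤ r → (c ≤ p r ↔ r ≤ conj p c) := by
  obtain ⟨N, hN⟩ := hp.2.2
  have hex : ∃ s, p (s + 1) < c := ⟨N, by rw [hN _ (by omega)]; omega⟩
  classical
  have key : ∀ r, 1 ≤ r → (c ≤ p r ↔ r ≤ Nat.find hex) := by
    intro r hr
    constructor
    · intro h
      by_contra hlt
      push Not at hlt
      have h2 := Nat.find_spec hex
      have := part_anti hp (i := Nat.find hex + 1) (j := r) (by omega) (by omega)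
      omega
    · intro h
      have := Nat.find_min hex (m := r - 1) (by omega)
      rw [Nat.sub_add_cancel hr] at this
      omega
  rw [conj_eq hp hc key]
  exact key

theorem restr_of {e y : ℕ} (hy1 : 1 ≤ y) (hye : y < e) {p : ℕ → ℕ} (hp : IsPartition p)
    (h : EYRestricted e y p) : Restr ((e : ℤ) - y) y p := by
  intro t ht j hpos
  by_contra hn
  obtain ⟨r, c, hj, ho, hno⟩ := hpos
  have hall : ∀ r c : ℤ, c - r = j + 1 → OutC p r c →
      OutC p (r - t * ((e : ℤ) - y)) (c + t * y) := by
    intro r c hrc hO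
    by_contra hO'
    exact hn ⟨r, c, hrc, hO, hO'⟩
  have h1 := hall r (c + 1) (by omega) (ho.mono hp le_rfl (by omega))
  have h2 : ¬ OutC p (r - 1) c := by
    intro hO
    exact hno ((hall (r - 1) c (by omega) hO).mono hp (by omega) le_rfl)
  have hty : (0 : ℤ) < t * y := by positivity
  have hta : (0 : ℤ) < t * ((e : ℤ) - y) := by
    apply mul_pos <;> omega
  obtain ⟨o1, o2, o3⟩ := ho
  obtain ⟨q1, q2, q3⟩ := h1
  set A : ℤ := t * ((e : ℤ) - y) with hA
  set B : ℤ := t * y with hB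
  have hE : A + B = (e : ℤ) * t := by rw [hA, hB]; ring
  have n1 : ((p (r - A).toNat : ℤ)) = c + B := by
    have : ¬ (p (r - A).toNat : ℤ) < c + B := fun hh => hno ⟨q1, by omega, hh⟩
    omega
  have n2 : c ≤ (p (r - 1).toNat : ℤ) := by
    by_contra hh
    exact h2 ⟨by omega, o2, by omega⟩
  have hconj : conj p c.toNat = (r - 1).toNat := by
    apply conj_eq hp (by omega)
    intro i hi
    constructor
    · intro hci
      by_contra hlt
      have := part_anti hp (i := r.toNat) (j := i) (by omega) (by omega)
      omega
    · intro hle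
      have := part_anti hp (i := i) (j := (r - 1).toNat) (by omega) (by omega)
      omega
  refine h t ht ⟨(r - A).toNat, c.toNat, by omega, by omega, by omega, ?_, ?_⟩
  · rw [hconj]
    zify
    have : ((e * t : ℕ) : ℤ) = A + B := by push_cast; linarith
    omega
  · have : ((y * t : ℕ) : ℤ) = B := by push_cast; rw [hB]; ring
    omega

theorem of_restr {e y : ℕ} (hy1 : 1 ≤ y) (hye : y < e) {p : ℕ → ℕ} (hp : IsPartition p)
    (h : Restr ((e : ℤ) - y) y p) : EYRestricted e y p := by
  rintro t ht ⟨r, c, hr, hc, hcp, hlen, harm⟩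
  have hcj := exists_conj hp hc
  have hty : (0 : ℤ) < t * y := by positivity
  have hta : (0 : ℤ) < t * ((e : ℤ) - y) := by
    apply mul_pos <;> omega
  have hle : r ≤ conj p c := (hcj r hr).1 hcp
  set A : ℤ := t * ((e : ℤ) - y) with hA
  set B : ℤ := t * y with hB
  have hE : ((e * t : ℕ) : ℤ) = A + B := by push_cast; rw [hA, hB]; ring
  have hY : ((y * t : ℕ) : ℤ) = B := by push_cast; rw [hB]; ring
  have hk : (conj p c : ℤ) = r + A - 1 := by omega
  have hpr : (p r : ℤ) = c + B := by omega
  have hpos : Pos ((e : ℤ) - y) y p t (c - (r + A)) := by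
    refine ⟨r + A, c, rfl, ⟨by omega, by omega, ?_⟩, ?_⟩
    · have := hcj (r + A).toNat (by omega)
      omega
    · rintro ⟨h1, h2, h3⟩
      rw [← hA, ← hB] at *
      rw [show ((r : ℤ) + A - A).toNat = r by omega] at h3
      omega
  obtain ⟨r', c', hj, ho, hno⟩ := h t ht _ hpos
  rw [← hA, ← hB] at hno
  apply hno
  have hc' : (c : ℤ) + 1 ≤ c' := by
    by_contra hlt
    have h0 : OutC p (r + A - 1) c := ho.mono hp (by omega) (by omega)
    have h1 := h0.2.2
    have := hcj ((r : ℤ) + A - 1).toNat (by omega)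
    omega
  have h0 : OutC p r (c + B + 1) := ⟨by omega, by omega, by
    rw [show ((r : ℤ)).toNat = r by omega]; omega⟩
  exact h0.mono hp (by omega) (by omega)

theorem cells_iff {p : ℕ → ℕ} {r c : ℤ} (hr : 1 ≤ r) (hc : 1 ≤ c) :
    (r, c) ∈ cells p ↔ ¬ OutC p r c := by
  constructor
  · rintro ⟨_, _, h⟩ ⟨_, _, h'⟩
    simp only at h
    omega
  · intro h
    refine ⟨hr, hc, ?_⟩
    by_contra h'
    exact h ⟨hr, hc, by simpa using h'⟩

theorem exists_box {p : ℕ → ℕ} (hp : IsPartition p) :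
    ∃ M : ℤ, 1 ≤ M ∧ ∀ r c : ℤ, 1 ≤ r → 1 ≤ c → (M ≤ r ∨ M ≤ c) → OutC p r c := by
  obtain ⟨N, hN⟩ := hp.2.2
  refine ⟨N + p 1 + 1, by omega, ?_⟩
  rintro r c hr hc (h | h)
  · refine ⟨hr, hc, ?_⟩
    rw [hN _ (by omega)]; omega
  · refine ⟨hr, hc, ?_⟩
    have := part_anti hp (i := 1) (j := r.toNat) le_rfl (by omega)
    omega

theorem cells_finite {p : ℕ → ℕ} (hp : IsPartition p) : (cells p).Finite := by
  obtain ⟨M, hM, h⟩ := exists_box hp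
  apply ((Set.finite_Icc (1 : ℤ) M).prod (Set.finite_Icc (1 : ℤ) M)).subset
  rintro ⟨r, c⟩ hx
  have h1 : 1 ≤ r := hx.1
  have h2 : 1 ≤ c := hx.2.1
  have h3 := (cells_iff h1 h2).1 hx
  have h4 : ¬ (M ≤ r ∨ M ≤ c) := fun hh => h3 (h r c h1 h2 hh)
  simp only [Set.mem_prod, Set.mem_Icc]
  omega

theorem II_content {a b : ℤ} (ha : 0 < a) (hb : 0 < b) {r c : ℤ} {t : ℕ} (hr : 1 ≤ r) (hc : 1 ≤ c)
    (h : (II a b r c).ncard ≤ t) : r ≤ t * a ∧ c ≤ t * b := by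
  constructor
  · by_contra hlt
    push Not at hlt
    have hsub : ((Finset.Icc (0 : ℤ) t : Finset ℤ) : Set ℤ) ⊆ II a b r c := by
      intro k hk
      simp only [Finset.coe_Icc, Set.mem_Icc] at hk
      constructor <;> nlinarith
    have := Set.ncard_le_ncard hsub (II_finite ha hb r c)
    rw [Set.ncard_coe_finset] at this
    simp at this
    omega
  · by_contra hlt
    push Not at hlt
    have hsub : ((Finset.Icc (-t : ℤ) 0 : Finset ℤ) : Set ℤ) ⊆ II a b r c := by
      intro k hk
      simp only [Finset.coe_Icc, Set.mem_Icc] at hk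
      constructor <;> nlinarith
    have := Set.ncard_le_ncard hsub (II_finite ha hb r c)
    rw [Set.ncard_coe_finset] at this
    simp at this
    omega

/-- for large count, ladders contain no nodes -/
theorem exists_T {a b : ℤ} (ha : 0 < a) (hb : 0 < b) {p : ℕ → ℕ} (hp : IsPartition p) :
    ∃ T : ℕ, 1 ≤ T ∧ ∀ r c : ℤ, T ≤ (II a b r c).ncard → SS a b p r c = II a b r c := by
  obtain ⟨M, hM⟩ := ((cells_finite hp).image (fun x => (II a b x.1 x.2).ncard)).bddAbove
  refine ⟨M + 1, by omega, ?_⟩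
  intro r c h
  by_contra hne
  have : ¬ II a b r c ⊆ SS a b p r c := fun hs => hne (Set.Subset.antisymm (SS_sub_II p r c) hs)
  obtain ⟨k, hk, hk'⟩ := Set.not_subset.1 this
  have hc : (r - k * a, c + k * b) ∈ cells p := (cells_iff hk.1 hk.2).2 hk'
  have h1 := hM (Set.mem_image_of_mem _ hc)
  simp only at h1
  rw [ncard_shift k (II_shift r c k)] at h1
  omega

theorem window_sub {e θ j : ℤ} (he : 0 < e) (t : ℕ) :
    {k : ℤ | θ < j + k * e ∧ j + k * e < θ + t * e} ⊆
      ((Finset.Ico ((θ - j) / e + 1) ((θ - j) / e + 1 + t) : Finset ℤ) : Set ℤ) := by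
  rintro k ⟨h1, h2⟩
  simp only [Finset.coe_Ico, Set.mem_Ico]
  constructor
  · have : (θ - j) / e < k := Int.ediv_lt_of_lt_mul he (by linarith)
    omega
  · have : k - t ≤ (θ - j) / e := Int.le_ediv_of_mul_le he (by linarith)
    omega

theorem window_finite {e θ j : ℤ} (he : 0 < e) (t : ℕ) :
    {k : ℤ | θ < j + k * e ∧ j + k * e < θ + t * e}.Finite :=
  (Finset.finite_toSet _).subset (window_sub he t)

theorem window_card_le {e θ j : ℤ} (he : 0 < e) (t : ℕ) :
    {k : ℤ | θ < j + k * e ∧ j + k * e < θ + t * e}.ncard ≤ t := by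
  have := Set.ncard_le_ncard (window_sub (θ := θ) (j := j) he t) (Finset.finite_toSet _)
  rw [Set.ncard_coe_finset] at this
  simpa using this

theorem window_card {e θ j : ℤ} (he : 0 < e) (t : ℕ) (hd : ∀ k, j + k * e ≠ θ) :
    {k : ℤ | θ < j + k * e ∧ j + k * e < θ + t * e}.ncard = t := by
  have : {k : ℤ | θ < j + k * e ∧ j + k * e < θ + t * e} =
      ((Finset.Ico ((θ - j) / e + 1) ((θ - j) / e + 1 + t) : Finset ℤ) : Set ℤ) := by
    apply Set.Subset.antisymm (window_sub he t)
    intro k hk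
    simp only [Finset.coe_Ico, Set.mem_Ico] at hk
    have h1 : θ - j < k * e := Int.lt_mul_of_ediv_lt he (by omega)
    have h2 : (k - t) * e ≤ θ - j := Int.mul_le_of_le_ediv he (by omega)
    have h3 := hd (k - t)
    refine ⟨by linarith, ?_⟩
    have : j + (k - t) * e < θ := lt_of_le_of_ne (by linarith) h3
    linarith
  rw [this, Set.ncard_coe_finset]
  simp

section restricted
variable {a b : ℤ} {q : ℕ → ℕ}

theorem Restr.le (h : Restr a b q) {t : ℕ} (ht : 1 ≤ t) {j j' : ℤ} (hj : j ≤ j')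
    (hp : Pos a b q t j) : Pos a b q t j' := by
  induction j', hj using Int.le_induction with
  | base => exact hp
  | succ n _ ih => exact h t ht n ih

theorem theta_exists (ha : 0 < a) (hb : 0 < b) (hq : IsPartition q) (h : Restr a b q) :
    ∃ θ : ℕ → ℤ, ∀ t, 1 ≤ t → ∀ j, Pos a b q t j ↔ θ t < j := by
  obtain ⟨M, hM, hbox⟩ := exists_box hq
  have : ∀ t : ℕ, ∃ x : ℤ, 1 ≤ t → ∀ j, Pos a b q t j ↔ x < j := by
    intro t
    by_cases ht : 1 ≤ t
    swap
    · exact ⟨0, fun h => absurd h ht⟩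
    have hta : (1 : ℤ) ≤ t * a := by
      have : (0 : ℤ) < t * a := by positivity
      omega
    have htb : (1 : ℤ) ≤ t * b := by
      have : (0 : ℤ) < t * b := by positivity
      omega
    obtain ⟨x, hx1, hx2⟩ := Int.exists_greatest_of_bdd (P := fun j => ¬ Pos a b q t j)
      ⟨M, fun z hz => by
        by_contra hlt
        push Not at hlt
        exact hz ⟨1, z + 1, by ring, hbox _ _ le_rfl (by omega) (by omega), fun hO => by
          have := hO.1; omega⟩⟩
      ⟨-(t * a) - M, by
        rintro ⟨r, c, hj, ho, hno⟩
        have := ho.1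
        have := ho.2.1
        exact hno (hbox _ _ (by omega) (by omega) (by omega))⟩
    refine ⟨x, fun _ j => ⟨fun hp => ?_, fun hlt => ?_⟩⟩
    · by_contra hle
      exact hx1 (h.le ht (not_lt.1 hle) hp)
    · by_contra hn
      have := hx2 j hn
      omega
  choose θ hθ using this
  exact ⟨θ, hθ⟩

theorem pos_notout (hq : IsPartition q) {t : ℕ} {r c : ℤ} (hpos : Pos a b q t (c - r))
    (h : ¬ OutC q r c) : ¬ OutC q (r - t * a + 1) (c + t * b + 1) := by
  obtain ⟨r', c', hj, ho, hno⟩ := hpos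
  have : r < r' := by
    by_contra hle
    exact h (ho.mono hq (by omega) (by omega))
  intro hO
  exact hno (hO.mono hq (by linarith) (by linarith))

theorem cx0 (ha : 0 < a) (hb : 0 < b) (hq : IsPartition q) (h : Restr a b q) {r c : ℤ}
    (hpos : Pos a b q 1 (c - r)) (hno : ¬ OutC q r c) (n : ℕ) :
    ¬ OutC q (r - n * a) (c + n * b) := by
  induction n with
  | zero => simpa using hno
  | succ n ih =>
    have h1 : Pos a b q 1 ((c + n * b) - (r - n * a)) := h.le le_rfl (by nlinarith) hpos
    have h2 := pos_notout hq h1 ih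
    intro hO
    apply h2
    refine hO.mono hq ?_ ?_ <;> push_cast <;> linarith

theorem cx (ha : 0 < a) (hb : 0 < b) (hq : IsPartition q) (h : Restr a b q) {r c : ℤ}
    (ho : OutC q r c) (k : ℕ) : ¬ OutC q (r - k * a) (c + k * b) →
    ∃ k' : ℕ, k' < k ∧ Pos a b q 1 ((c + k' * b) - (r - k' * a)) ∧
     ∀ l : ℕ, k' < l → ¬ OutC q (r - l * a) (c + l * b) := by
  induction k with
  | zero => intro hno; simp at hno; exact absurd ho hno
  | succ k ih =>
    intro hno
    by_cases hk : OutC q (r - k * a) (c + k * b)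
    · have hpos : Pos a b q 1 ((c + k * b) - (r - k * a)) := by
        refine ⟨_, _, rfl, hk, fun hO => hno ?_⟩
        refine hO.mono hq ?_ ?_ <;> push_cast <;> linarith
      refine ⟨k, by omega, hpos, fun l hl => ?_⟩
      have h1 : Pos a b q 1 ((c + (k + 1 : ℕ) * b) - (r - (k + 1 : ℕ) * a)) :=
        h.le le_rfl (by push_cast; linarith) hpos
      have h2 := cx0 ha hb hq h h1 hno (l - (k + 1))
      intro hO
      apply h2
      have : ((l - (k + 1) : ℕ) : ℤ) = l - (k + 1) := by omega
      rw [this]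
      refine hO.mono hq ?_ ?_ <;> push_cast <;> linarith
    · obtain ⟨k', h1, h2, h3⟩ := ih hk
      exact ⟨k', by omega, h2, h3⟩

/-- lower bound on contents of outside points -/
theorem lower (ha : 0 < a) (hb : 0 < b) (hq : IsPartition q) (h : Restr a b q) {r c : ℤ}
    (ho : OutC q r c) {t : ℕ} (ht : NN a b q r c = t) (_ht1 : 1 ≤ t) :
    Pos a b q t (c - r) := by
  by_contra hn
  have h1 : OutC q (r - t * a) (c + t * b) := by
    by_contra h1
    exact hn ⟨r, c, rfl, ho, h1⟩
  have hsub : ((Finset.Icc (0 : ℤ) t : Finset ℤ) : Set ℤ) ⊆ SS a b q r c := by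
    intro k hk
    simp only [Finset.coe_Icc, Set.mem_Icc] at hk
    lift k to ℕ using hk.1
    by_contra hko
    obtain ⟨k', hk', _, h2⟩ := cx ha hb hq h ho k hko
    exact h2 t (by omega) h1
  have := Set.ncard_le_ncard hsub (SS_finite ha hb q r c)
  rw [Set.ncard_coe_finset] at this
  simp [NN] at this ht
  omega

theorem notouch (ha : 0 < a) (hb : 0 < b) (hq : IsPartition q) (h : Restr a b q) {t : ℕ}
    (ht1 : 1 ≤ t) {j : ℤ} (hp : Pos a b q t j) (hp' : ¬ Pos a b q (t + 1) (j - (a + b))) :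
    ∃ r c : ℤ, c - r = j ∧ NN a b q r c = t := by
  obtain ⟨M, hM, hbox⟩ := exists_box hq
  obtain ⟨r0, c0, hj, ho0, hno0⟩ := hp
  -- maximal along the diagonal
  obtain ⟨s, hs1, hs2⟩ := Int.exists_greatest_of_bdd
    (P := fun s : ℤ => ¬ OutC q (r0 + s - t * a) (c0 + s + t * b))
    ⟨M + |r0 - t * a| + |c0 + t * b|, fun z hz => by
      by_contra hlt
      have := neg_abs_le (r0 - t * a)
      have := neg_abs_le (c0 + t * b)
      have := abs_nonneg (r0 - t * a)
      have := abs_nonneg (c0 + t * b)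
      exact hz (hbox _ _ (by linarith) (by linarith) (by left; linarith))⟩
    ⟨0, by simpa using hno0⟩
  have hs0 : 0 ≤ s := hs2 0 (by simpa using hno0)
  set r := r0 + s with hr
  set c := c0 + s with hc
  have ho : OutC q r c := ho0.mono hq (by omega) (by omega)
  have hplus : OutC q (r - t * a + 1) (c + t * b + 1) := by
    by_contra hn
    have := hs2 (s + 1) (fun hO => hn (hO.mono hq (by linarith) (by linarith)))
    omega
  have hcr : c - r = j := by omega
  refine ⟨r, c, hcr, ?_⟩
  have hSS : SS a b q r c = ((Finset.Ico (0 : ℤ) t : Finset ℤ) : Set ℤ) := by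
    have hin : ∀ k : ℕ, k < t → OutC q (r - k * a) (c + k * b) := by
      intro k hk
      by_contra hko
      obtain ⟨k', hk', hpos, h2⟩ := cx ha hb hq h ho k hko
      have hT := h2 (t - 1) (by omega)
      have hcast : ((t - 1 : ℕ) : ℤ) = t - 1 := by omega
      have hk1 : (k' : ℤ) ≤ t - 1 := by omega
      have := pos_notout hq (h.le le_rfl (j' := (c + (t - 1 : ℕ) * b) - (r - (t - 1 : ℕ) * a))
        (by rw [hcast]; nlinarith) hpos) hT
      apply this
      rw [hcast]
      refine hplus.mono hq ?_ ?_ <;> push_cast <;> linarith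
    have hm1 : ¬ OutC q (r + a) (c - b) := by
      intro hO
      apply hp'
      refine ⟨r + a, c - b, by omega, hO, fun hO' => hs1 ?_⟩
      refine hO'.mono hq ?_ ?_ <;> push_cast <;> linarith
    ext k
    simp only [Finset.coe_Ico, Set.mem_Ico]
    constructor
    · intro hk
      constructor
      · by_contra hlt
        push Not at hlt
        obtain ⟨n, rfl⟩ : ∃ n : ℕ, k = -(n + 1 : ℕ) := ⟨(-k - 1).toNat, by omega⟩
        have hk : OutC q (r - -(n + 1 : ℕ) * a) (c + -(n + 1 : ℕ) * b) := hk
        have hno : ¬ OutC q (r - -(n + 1 : ℕ) * a - n * a) (c + -(n + 1 : ℕ) * b + n * b) := by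
          intro hO
          apply hm1
          refine hO.mono hq ?_ ?_ <;> push_cast <;> linarith
        obtain ⟨k', hk', _, h2⟩ := cx ha hb hq h hk n hno
        apply h2 (n + 1) (by omega)
        exact ho.mono hq (by push_cast; linarith) (by push_cast; linarith)
      · by_contra hle
        push Not at hle
        lift k to ℕ using by omega
        obtain ⟨k', hk', _, h2⟩ := cx ha hb hq h ho t hs1
        exact h2 k (by omega) hk
    · rintro ⟨h1, h2⟩
      lift k to ℕ using h1
      exact hin k (by omega)
  rw [NN, hSS, Set.ncard_coe_finset]
  simp

theorem base_claim (ha : 0 < a) (hb : 0 < b) (hq : IsPartition q) {m : ℕ → ℕ} (hm : IsPartition m)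
    {θ : ℕ → ℤ} (hθ : ∀ t, 1 ≤ t → ∀ j, Pos a b q t j ↔ θ t < j) :
    ∃ T : ℕ, 1 ≤ T ∧ ∀ t, T ≤ t → ∀ r c : ℤ, OutC m r c → NN a b m r c ≤ t →
      c - r < θ t + t * (a + b) := by
  obtain ⟨T, hT1, hT⟩ := exists_T ha hb hm
  refine ⟨T + q 1, by omega, ?_⟩
  intro t ht r c ho hN
  have hII : (II a b r c).ncard ≤ t := by
    by_cases hle : T ≤ (II a b r c).ncard
    · rw [← hT r c hle]; exact hN
    · omega
  have h1 := (II_content ha hb ho.1 ho.2.1 hII).2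
  have hθt : -(t * a) ≤ θ t := by
    by_contra hlt
    push Not at hlt
    obtain ⟨r', c', hj, ho', hno'⟩ := (hθ t (by omega) _).2 hlt
    apply hno'
    have := ho'.2.1
    refine ⟨by omega, by nlinarith, ?_⟩
    have h2 := part_anti hq (i := 1) (j := (r' - t * a).toNat) le_rfl (by omega)
    have h3 : (t : ℤ) ≤ t * b := by nlinarith
    omega
  have := ho.1
  nlinarith

theorem step_claim (ha : 0 < a) (hb : 0 < b) (hq : IsPartition q) (h : Restr a b q)
    {m : ℕ → ℕ} (hm : IsPartition m) (hN : ∀ r c, NN a b m r c = NN a b q r c)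
    {θ : ℕ → ℤ} (hθ : ∀ t, 1 ≤ t → ∀ j, Pos a b q t j ↔ θ t < j) {t : ℕ} (ht : 1 ≤ t)
    (ih : ∀ r c : ℤ, OutC m r c → NN a b m r c ≤ t + 1 →
      c - r < θ (t + 1) + (t + 1 : ℕ) * (a + b)) :
    ∀ r c : ℤ, OutC m r c → NN a b m r c ≤ t → c - r < θ t + t * (a + b) := by
  have key : ∀ n : ℕ, ∀ r c : ℤ, c - r = θ (t + 1) + (t + 1 : ℕ) * (a + b) - n →
      OutC m r c → NN a b m r c ≤ t → c - r < θ t + t * (a + b) := by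
    intro n
    induction n with
    | zero =>
      intro r c hc ho hNN
      have := ih r c ho (by omega)
      simp at hc; simp at this; omega
    | succ n ihn =>
      intro r c hc ho hNN
      by_contra hge
      push Not at hge
      push_cast at hc
      -- point at next content
      have hp1 : Pos a b q t (c - r + 1 - t * (a + b)) := (hθ t ht _).2 (by linarith)
      have hp2 : ¬ Pos a b q (t + 1) (c - r + 1 - t * (a + b) - (a + b)) := by
        rw [hθ (t + 1) (by omega)]
        push Not
        rw [hc]
        linarith
      obtain ⟨r1, c1, hj, hN1⟩ := notouch ha hb hq h ht hp1 hp2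
      set r' := r1 - t * a with hr'
      set c' := c1 + t * b with hc'
      have hN' : NN a b m r' c' = t := by rw [hN, hr', hc', NN_shift, hN1]
      have hcr : c' - r' = c - r + 1 := by linarith
      have hO' : OutC m r' c' := by
        by_cases hcc : r ≤ r'
        · exact ho.mono hm hcc (by omega)
        · have hs : SS a b m r' c' ⊆ SS a b m r c := SS_mono hm (by omega) (by omega)
          have heq := Set.eq_of_subset_of_ncard_le hs (by
            change NN a b m r c ≤ NN a b m r' c'; omega) (SS_finite ha hb _ _ _)
          have h0 : (0 : ℤ) ∈ SS a b m r c := by simpa [SS] using ho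
          rw [← heq] at h0
          simpa [SS] using h0
      have := ihn r' c' (by push_cast; omega) hO' hN'.le
      omega
  intro r c ho hNN
  by_cases hlt : c - r < θ (t + 1) + (t + 1 : ℕ) * (a + b)
  · exact key (θ (t + 1) + (t + 1 : ℕ) * (a + b) - (c - r)).toNat r c (by omega) ho hNN
  · exact absurd (ih r c ho (by omega)) hlt

theorem claim (ha : 0 < a) (hb : 0 < b) (hq : IsPartition q) (h : Restr a b q)
    {m : ℕ → ℕ} (hm : IsPartition m) (hN : ∀ r c, NN a b m r c = NN a b q r c)
    {θ : ℕ → ℤ} (hθ : ∀ t, 1 ≤ t → ∀ j, Pos a b q t j ↔ θ t < j) :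
    ∀ t : ℕ, 1 ≤ t → ∀ r c : ℤ, OutC m r c → NN a b m r c ≤ t → c - r < θ t + t * (a + b) := by
  obtain ⟨T, hT1, hT⟩ := base_claim ha hb hq hm hθ
  have : ∀ n t : ℕ, 1 ≤ t → T ≤ t + n → ∀ r c : ℤ, OutC m r c → NN a b m r c ≤ t →
      c - r < θ t + t * (a + b) := by
    intro n
    induction n with
    | zero => intro t ht hTt; exact hT t (by omega)
    | succ n ih =>
      intro t ht hTt
      exact step_claim ha hb hq h hm hN hθ ht (ih (t + 1) (by omega) (by omega))
  intro t ht
  exact this T t ht (by omega)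

theorem ladder_le (ha : 0 < a) (hb : 0 < b) (hq : IsPartition q) (h : Restr a b q)
    {m : ℕ → ℕ} (hm : IsPartition m) (hN : ∀ r c, NN a b m r c = NN a b q r c) (r c k0 : ℤ) :
    {k | k ∈ SS a b m r c ∧ k0 ≤ k}.ncard ≤ {k | k ∈ SS a b q r c ∧ k0 ≤ k}.ncard := by
  obtain ⟨θ, hθ⟩ := theta_exists ha hb hq h
  have hfm := SS_finite ha hb m r c
  have hfq := SS_finite ha hb q r c
  by_cases ht : NN a b q r c = 0
  · have : NN a b m r c = 0 := by rw [hN, ht]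
    have : SS a b m r c = ∅ := (Set.ncard_eq_zero hfm).1 this
    simp [this]
  set t := NN a b q r c with htd
  have ht1 : 1 ≤ t := by omega
  have e0 : 0 < a + b := by omega
  have hup : ∀ k, k ∈ SS a b m r c → (c - r) + k * (a + b) < θ t + t * (a + b) := by
    intro k hk
    have := claim ha hb hq h hm hN hθ t ht1 _ _ hk (by rw [NN_shift, hN])
    linarith
  have hupq : ∀ k, k ∈ SS a b q r c → (c - r) + k * (a + b) < θ t + t * (a + b) := by
    intro k hk
    have := claim ha hb hq h hq (fun _ _ => rfl) hθ t ht1 _ _ hk (by rw [NN_shift])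
    linarith
  have hlow : ∀ k, k ∈ SS a b q r c → θ t < (c - r) + k * (a + b) := by
    intro k hk
    have := lower ha hb hq h hk (by rw [NN_shift]) ht1
    have := (hθ t ht1 _).1 this
    linarith
  have hW : SS a b q r c =
      {k : ℤ | θ t < (c - r) + k * (a + b) ∧ (c - r) + k * (a + b) < θ t + t * (a + b)} :=
    Set.eq_of_subset_of_ncard_le (fun k hk => ⟨hlow k hk, hupq k hk⟩)
      (window_card_le e0 t) (window_finite e0 t)
  by_cases hall : ∀ k ∈ SS a b q r c, k0 ≤ k
  · have h1 : {k | k ∈ SS a b q r c ∧ k0 ≤ k} = SS a b q r c := by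
      ext k; exact ⟨fun hk => hk.1, fun hk => ⟨hk, hall k hk⟩⟩
    rw [h1]
    change _ ≤ NN a b q r c
    rw [← hN]
    exact Set.ncard_le_ncard (fun k hk => hk.1) hfm
  · push Not at hall
    obtain ⟨k1, hk1, hlt⟩ := hall
    apply Set.ncard_le_ncard _ (hfq.subset (fun k hk => hk.1))
    rintro k ⟨hk, hkk⟩
    refine ⟨?_, hkk⟩
    rw [hW]
    refine ⟨?_, hup k hk⟩
    have := hlow k1 hk1
    nlinarith

end restricted

/-! Construction of the restricted partition -/

def NT (a b : ℤ) (p : ℕ → ℕ) (t : ℕ) (j : ℤ) : Prop :=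
  ∃ r c : ℤ, c - r = j ∧ NN a b p r c = t

theorem NT_period {a b : ℤ} {p : ℕ → ℕ} {t : ℕ} {j : ℤ} (k : ℤ) (h : NT a b p t j) :
    NT a b p t (j + k * (a + b)) := by
  obtain ⟨r, c, hj, hN⟩ := h
  exact ⟨r - k * a, c + k * b, by rw [← hj]; ring, by rw [NN_shift, hN]⟩

theorem touch_exists {a b : ℤ} (ha : 0 < a) (hb : 0 < b) {p : ℕ → ℕ} (hp : IsPartition p)
    {t : ℕ} (ht : 1 ≤ t) : ∃ j, ¬ NT a b p t j := by
  by_contra hall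
  push Not at hall
  obtain ⟨r0, c0, hj0, hN0⟩ := hall 0
  have key : ∀ n : ℕ, ∃ r c : ℤ, c - r = n ∧ NN a b p r c = t ∧
      SS a b p r c = SS a b p r0 c0 := by
    intro n
    induction n with
    | zero => exact ⟨r0, c0, by simpa using hj0, hN0, rfl⟩
    | succ n ih =>
      obtain ⟨r, c, h1, h2, h3⟩ := ih
      obtain ⟨r', c', h1', h2'⟩ := hall ((n + 1 : ℕ) : ℤ)
      refine ⟨r', c', h1', h2', ?_⟩
      rw [← h3]
      exact (SS_eq ha hb hp (by right; push_cast at h1'; omega) (by omega)).symm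
  obtain ⟨r, c, h1, h2, h3⟩ := key (a + b).toNat
  have h4 : SS a b p r c = SS a b p (r0 - 1 * a) (c0 + 1 * b) :=
    SS_eq ha hb hp (by left; omega) (by rw [NN_shift]; omega)
  have hshift : ∀ l, l ∈ SS a b p r0 c0 ↔ l + 1 ∈ SS a b p r0 c0 := by
    intro l
    rw [← SS_shift, ← h4, h3]
  have hfin := SS_finite ha hb p r0 c0
  have hne : (SS a b p r0 c0).Nonempty := by
    rw [← Set.ncard_pos hfin]
    change 0 < NN a b p r0 c0
    omega
  obtain ⟨x, hx, hmax⟩ := Set.exists_max_image _ id hfin hne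
  have := hmax (x + 1) ((hshift x).1 hx)
  simp at this

theorem F_exists {a b : ℤ} (ha : 0 < a) (hb : 0 < b) {p : ℕ → ℕ} (hp : IsPartition p)
    {t : ℕ} (ht : 1 ≤ t) (x : ℤ) : ∃ z, ¬ NT a b p t z ∧ z ≤ x ∧ x - (a + b) ≤ z ∧
      ∀ j, z < j → j ≤ x → NT a b p t j := by
  obtain ⟨j0, hj0⟩ := touch_exists ha hb hp ht
  have hper : ∀ j k : ℤ, ¬ NT a b p t j → ¬ NT a b p t (j + k * (a + b)) := by
    intro j k h h'
    apply h
    have := NT_period (-k) h'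
    rwa [show j + k * (a + b) + -k * (a + b) = j by ring] at this
  obtain ⟨z, ⟨hz1, hz1'⟩, hz2⟩ := Int.exists_greatest_of_bdd
    (P := fun z => ¬ NT a b p t z ∧ z ≤ x) ⟨x, fun z hz => hz.2⟩
    ⟨j0 + (-(|j0 - x|)) * (a + b), hper _ _ hj0, by
      have := le_abs_self (j0 - x)
      have := abs_nonneg (j0 - x)
      nlinarith⟩
  refine ⟨z, hz1, hz1', ?_, ?_⟩
  · by_contra hlt
    have := hz2 (z + 1 * (a + b)) ⟨hper _ _ hz1, by linarith⟩
    linarith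
  · intro j h1 h2
    by_contra hn
    have := hz2 j ⟨hn, h2⟩
    omega

theorem theta_construct {a b : ℤ} (ha : 0 < a) (hb : 0 < b) {p : ℕ → ℕ} (hp : IsPartition p)
    {T : ℕ} (hT1 : 1 ≤ T)
    (hT : ∀ r c : ℤ, T ≤ (II a b r c).ncard → SS a b p r c = II a b r c) :
    ∃ θ : ℕ → ℤ, (∀ t, T ≤ t → θ t = -(t * a)) ∧
      ∀ t, 1 ≤ t → ¬ NT a b p t (θ t) ∧ θ (t + 1) ≤ θ t ∧ θ t ≤ θ (t + 1) + (a + b) ∧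
        ∀ j, θ t < j → j ≤ θ (t + 1) + (a + b) → NT a b p t j := by
  have hF : ∀ t : ℕ, ∀ x : ℤ, ∃ z, 1 ≤ t → ¬ NT a b p t z ∧ z ≤ x ∧ x - (a + b) ≤ z ∧
      ∀ j, z < j → j ≤ x → NT a b p t j := by
    intro t x
    by_cases ht : 1 ≤ t
    · obtain ⟨z, hz⟩ := F_exists ha hb hp ht x
      exact ⟨z, fun _ => hz⟩
    · exact ⟨0, fun h => absurd h ht⟩
  choose F hF using hF
  let g : ℕ → ℤ := fun n => Nat.rec (-(T * a)) (fun n x => F (T - n - 1) (x + (a + b))) n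
  have g0 : g 0 = -(T * a) := rfl
  have gs : ∀ n, g (n + 1) = F (T - n - 1) (g n + (a + b)) := fun n => rfl
  refine ⟨fun t => if T ≤ t then -(t * a) else g (T - t), ?_, ?_⟩
  · intro t ht; simp [ht]
  · intro t ht
    by_cases hTt : T ≤ t
    · simp only [hTt, if_true, show T ≤ t + 1 by omega]
      push_cast
      refine ⟨?_, by linarith, by linarith, ?_⟩
      · rintro ⟨r, c, hj, hN⟩
        have hle : NN a b p r c ≤ (II a b r c).ncard :=
          Set.ncard_le_ncard (SS_sub_II p r c) (II_finite ha hb r c)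
        have hS := hT r c (by omega)
        have hII : (II a b r c).ncard = t := by rw [← hS]; exact hN
        have hsub : II a b r c ⊆ ((Finset.Ioo (0 : ℤ) t : Finset ℤ) : Set ℤ) := by
          intro k hk
          have h1 := II_content ha hb (t := t) hk.1 hk.2 (by
            rw [ncard_shift k (II_shift r c k), hII])
          have h3 := hk.1
          have h4 := hk.2
          simp only [Finset.coe_Ioo, Set.mem_Ioo]
          constructor
          · by_contra hk0
            push Not at hk0
            nlinarith
          · by_contra hk0
            push Not at hk0
            nlinarith
        have := Set.ncard_le_ncard hsub (Finset.finite_toSet _)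
        rw [Set.ncard_coe_finset, hII] at this
        simp at this
        omega
      · intro j h1 h2
        have hII : II a b (t * a) (t * a + j) =
            ((Finset.Ico (0 : ℤ) t : Finset ℤ) : Set ℤ) := by
          ext k
          simp only [Finset.coe_Ico, Set.mem_Ico]
          constructor
          · rintro ⟨h3, h4⟩
            constructor
            · by_contra hk0
              push Not at hk0
              nlinarith
            · by_contra hk0
              push Not at hk0
              nlinarith
          · rintro ⟨h3, h4⟩
            constructor <;> nlinarith
        have hc : (II a b (t * a) (t * a + j)).ncard = t := by
          rw [hII, Set.ncard_coe_finset]; simp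
        refine ⟨t * a, t * a + j, by ring, ?_⟩
        rw [NN, hT _ _ (by omega), hc]
    · have hth : (if T ≤ t + 1 then -(((t + 1 : ℕ) : ℤ) * a) else g (T - (t + 1))) =
          g (T - (t + 1)) := by
        split_ifs with h
        · have : T = t + 1 := by omega
          rw [← this, Nat.sub_self, g0]
        · rfl
      simp only [hTt, if_false]
      rw [hth]
      have h1 : g (T - t) = F t (g (T - (t + 1)) + (a + b)) := by
        have := gs (T - (t + 1))
        rw [show T - (t + 1) + 1 = T - t by omega, show T - (T - (t + 1)) - 1 = t by omega] at this
        exact this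
      have h2 := hF t (g (T - (t + 1)) + (a + b)) ht
      rw [← h1] at h2
      exact ⟨h2.1, by linarith [h2.2.2.1], h2.2.1, h2.2.2.2⟩

theorem build (O : ℤ → ℤ → Prop) (hquad : ∀ r c, O r c → 1 ≤ r ∧ 1 ≤ c)
    (h1 : ∀ r c, O r c → O (r + 1) c) (h2 : ∀ r c, O r c → O r (c + 1))
    (hbox : ∃ M : ℤ, 1 ≤ M ∧ ∀ r c : ℤ, 1 ≤ r → 1 ≤ c → (M ≤ r ∨ M ≤ c) → O r c) :
    ∃ q, IsPartition q ∧ ∀ r c, OutC q r c ↔ O r c := by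
  classical
  obtain ⟨M, hM, hbox⟩ := hbox
  have hex : ∀ r : ℕ, ∃ n : ℕ, 1 ≤ r → O r (n + 1) := fun r =>
    ⟨M.toNat, fun hr => hbox _ _ (by omega) (by omega) (by right; omega)⟩
  have hr : ∀ r (c c' : ℤ), c ≤ c' → O r c → O r c' := by
    intro r c c' hc hO
    induction c', hc using Int.le_induction with
    | base => exact hO
    | succ n _ ih => exact h2 _ _ ih
  have hq0 : Nat.find (hex 0) = 0 := by
    rw [Nat.find_eq_zero]; intro h; omega
  refine ⟨fun r => Nat.find (hex r), ⟨hq0, ?_, M.toNat, ?_⟩, ?_⟩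
  · intro r hr1
    apply Nat.find_min'
    intro _
    have := Nat.find_spec (hex r) hr1
    push_cast
    exact h1 _ _ this
  · intro r hMr
    rw [Nat.find_eq_zero]
    intro hr1
    exact hbox _ _ (by omega) (by omega) (by left; omega)
  · intro r c
    constructor
    · rintro ⟨hr1, hc1, hlt⟩
      have := Nat.find_spec (hex r.toNat) (by omega)
      simp only at hlt
      have h3 := hr _ _ c (by omega) this
      rwa [show ((r.toNat : ℕ) : ℤ) = r by omega] at h3
    · intro hO
      have hq := hquad r c hO
      refine ⟨hq.1, hq.2, ?_⟩
      have : Nat.find (hex r.toNat) ≤ (c - 1).toNat := by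
        apply Nat.find_min'
        intro _
        rw [show ((r.toNat : ℕ) : ℤ) = r by omega, show (((c - 1).toNat : ℕ) : ℤ) + 1 = c by omega]
        exact hO
      simp only
      omega

theorem existence {a b : ℤ} (ha : 0 < a) (hb : 0 < b) {p : ℕ → ℕ} (hp : IsPartition p) :
    ∃ q, IsPartition q ∧ (∀ r c, NN a b p r c = NN a b q r c) ∧ Restr a b q := by
  obtain ⟨T, hT1, hT⟩ := exists_T ha hb hp
  obtain ⟨θ, hθT, hθ⟩ := theta_construct ha hb hp hT1 hT
  have e0 : 0 < a + b := by omega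
  have mono1 : ∀ s t : ℕ, 1 ≤ s → s ≤ t → θ t ≤ θ s := by
    intro s t hs hst
    induction t, hst using Nat.le_induction with
    | base => exact le_rfl
    | succ n hn ih => exact (hθ n (by omega)).2.1.trans ih
  have mono2 : ∀ s t : ℕ, 1 ≤ s → s ≤ t → θ s + s * (a + b) ≤ θ t + t * (a + b) := by
    intro s t hs hst
    induction t, hst using Nat.le_induction with
    | base => exact le_rfl
    | succ n hn ih =>
      have := (hθ n (by omega)).2.2.1
      push_cast
      linarith
  -- contents of points avoid touches
  have avoid : ∀ r c : ℤ, 1 ≤ NN a b p r c → ∀ k : ℤ, c - r + k * (a + b) ≠ θ (NN a b p r c) := by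
    intro r c h k hk
    apply (hθ _ h).1
    rw [← hk]
    exact NT_period k ⟨r, c, rfl, rfl⟩
  have NNmono : ∀ r c r' c' : ℤ, r ≤ r' → c ≤ c' → NN a b p r c ≤ NN a b p r' c' := fun r c r' c' h h' =>
    Set.ncard_le_ncard (SS_mono hp h h') (SS_finite ha hb _ _ _)
  let O : ℤ → ℤ → Prop := fun r c => θ (NN a b p r c) < c - r ∧
    c - r < θ (NN a b p r c) + (NN a b p r c) * (a + b)
  have Opos : ∀ r c, O r c → 1 ≤ NN a b p r c := by
    rintro r c ⟨h1, h2⟩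
    by_contra h
    have : NN a b p r c = 0 := by omega
    rw [this] at h1 h2
    simp at h2
    omega
  have O1 : ∀ r c, O r c → O (r + 1) c := by
    intro r c hO
    have h1 := Opos r c hO
    obtain ⟨hl, hu⟩ := hO
    have h2 := NNmono r c (r + 1) c (by omega) le_rfl
    have h3 := mono1 _ _ h1 h2
    have h4 := mono2 _ _ h1 h2
    have h5 := avoid (r + 1) c (by omega) 0
    refine ⟨lt_of_le_of_ne (by omega) (fun hh => h5 ?_), by linarith⟩
    rw [hh]; ring
  have O2 : ∀ r c, O r c → O r (c + 1) := by
    intro r c hO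
    have h1 := Opos r c hO
    obtain ⟨hl, hu⟩ := hO
    have h2 := NNmono r c r (c + 1) le_rfl (by omega)
    have h3 := mono1 _ _ h1 h2
    have h4 := mono2 _ _ h1 h2
    have h5 := avoid r (c + 1) (by omega) (-(NN a b p r (c + 1)))
    refine ⟨by linarith, lt_of_le_of_ne (by linarith) (fun hh => h5 ?_)⟩
    rw [hh]; ring
  have O1n : ∀ r c, O r c → ∀ n : ℕ, O (r + n) c := by
    intro r c hO n
    induction n with
    | zero => simpa using hO
    | succ n ih => have := O1 _ _ ih; push_cast; rwa [← add_assoc]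
  have O2n : ∀ r c, O r c → ∀ n : ℕ, O r (c + n) := by
    intro r c hO n
    induction n with
    | zero => simpa using hO
    | succ n ih => have := O2 _ _ ih; push_cast; rwa [← add_assoc]
  have big : ∀ r c : ℤ, T ≤ (II a b r c).ncard → (O r c ↔ 1 ≤ r ∧ 1 ≤ c) := by
    intro r c h
    have hS := hT r c h
    have hN : NN a b p r c = (II a b r c).ncard := by rw [NN, hS]
    have hsub : II a b r c ⊆ {k : ℤ | θ (NN a b p r c) < (c - r) + k * (a + b) ∧
        (c - r) + k * (a + b) < θ (NN a b p r c) + (NN a b p r c) * (a + b)} := by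
      intro k hk
      have h1 := II_content ha hb (t := NN a b p r c) hk.1 hk.2 (by
            rw [ncard_shift k (II_shift r c k), hN])
      have h3 := hk.1
      have h4 := hk.2
      have h5 := hθT (NN a b p r c) (by omega)
      constructor
      · rw [h5]; linarith
      · rw [h5]; linarith
    have heq := Set.eq_of_subset_of_ncard_le hsub (by rw [← hN]; exact window_card_le e0 _)
      (window_finite e0 _)
    have h0 : (0 : ℤ) ∈ II a b r c ↔ 1 ≤ r ∧ 1 ≤ c := by simp [II]
    rw [← h0, heq]
    simp [O]
  have IIbig : ∀ r c k : ℤ, 1 ≤ r - k * a → 1 ≤ c + k * b → (T * a < r - k * a ∨ T * b < c + k * b) →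
      T ≤ (II a b r c).ncard := by
    intro r c k h1 h2 h3
    by_contra hlt
    have := II_content ha hb (t := T) h1 h2 (by rw [ncard_shift k (II_shift r c k)]; omega)
    omega
  have hTa : 0 ≤ (T : ℤ) * a := by positivity
  have hTb : 0 ≤ (T : ℤ) * b := by positivity
  have Oquad : ∀ r c, O r c → 1 ≤ r ∧ 1 ≤ c := by
    intro r c hO
    constructor
    · by_contra hr
      push Not at hr
      have h1 : T ≤ (II a b r (c + (T * b + 1 + |c| + (1 - r) * b).toNat)).ncard := by
        have h4 := neg_abs_le c
        have h5 := abs_nonneg c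
        have h6 : 0 ≤ (1 - r) * b := by apply mul_nonneg <;> omega
        rw [Int.toNat_of_nonneg (by omega)]
        apply IIbig _ _ (-(1 - r))
        · nlinarith
        · linarith
        · right; linarith
      have := (big _ _ h1).1 (O2n r c hO _)
      omega
    · by_contra hc
      push Not at hc
      have h1 : T ≤ (II a b (r + (T * a + 1 + |r| + (1 - c) * a).toNat) c).ncard := by
        have h4 := neg_abs_le r
        have h5 := abs_nonneg r
        have h6 : 0 ≤ (1 - c) * a := by apply mul_nonneg <;> omega
        rw [Int.toNat_of_nonneg (by omega)]
        apply IIbig _ _ (1 - c)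
        · linarith
        · nlinarith
        · left; linarith
      have := (big _ _ h1).1 (O1n r c hO _)
      omega
  obtain ⟨q, hq, hqO⟩ := build O Oquad O1 O2 ⟨T * a + T * b + 1, by omega, by
    intro r c hr hc h
    refine (big r c (IIbig r c 0 (by simpa using hr) (by simpa using hc) ?_)).2 ⟨hr, hc⟩
    simp only [zero_mul, sub_zero, add_zero]
    omega⟩
  refine ⟨q, hq, ?_, ?_⟩
  · intro r c
    have hS : SS a b q r c = {k : ℤ | θ (NN a b p r c) < (c - r) + k * (a + b) ∧
        (c - r) + k * (a + b) < θ (NN a b p r c) + (NN a b p r c) * (a + b)} := by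
      ext k
      change OutC q (r - k * a) (c + k * b) ↔ _
      rw [hqO]
      change (θ (NN a b p (r - k * a) (c + k * b)) < _ ∧ _ < θ (NN a b p (r - k * a) (c + k * b)) +
        (NN a b p (r - k * a) (c + k * b)) * _) ↔ (_ ∧ _)
      rw [NN_shift, show c + k * b - (r - k * a) = c - r + k * (a + b) by ring]
    rw [NN.eq_def a b q, hS]
    by_cases h : 1 ≤ NN a b p r c
    · rw [window_card e0 _ (avoid r c h)]
    · have := window_card_le (θ := θ (NN a b p r c)) (j := c - r) e0 (NN a b p r c)
      omega
  · have hpos : ∀ t : ℕ, 1 ≤ t → ∀ j, Pos a b q t j ↔ θ t < j := by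
      intro t ht j
      constructor
      · rintro ⟨r, c, hj, ho, hno⟩
        rw [hqO] at ho hno
        have hs := Opos r c ho
        have hav := avoid r c hs t
        obtain ⟨hl, hu⟩ := ho
        simp only [O] at hno
        rw [NN_shift] at hno
        set s := NN a b p r c with hsd
        rw [show c + t * b - (r - t * a) = c - r + t * (a + b) by ring] at hno
        have hte : 0 ≤ t * (a + b) := by positivity
        have hge : θ s + s * (a + b) ≤ c - r + t * (a + b) := by
          by_contra hlt
          exact hno ⟨by linarith, by linarith⟩
        rcases le_total t s with hts | hts
        · have h1 := mono2 t s ht hts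
          refine lt_of_le_of_ne (by linarith) ?_
          intro hh
          have := avoid r c hs ((t : ℤ) - s)
          apply this
          rw [← hsd]
          have h2 : θ s + s * (a + b) = θ t + t * (a + b) := by linarith
          rw [hj, ← hh]
          linarith
        · have := mono1 s t hs hts
          linarith
      · intro hlt
        -- find s
        have hex : ∃ s : ℕ, t < s ∧ j + t * (a + b) ≤ θ s + s * (a + b) := by
          refine ⟨T + t + 1 + (j + t * (a + b)).toNat, by omega, ?_⟩
          rw [hθT _ (by omega)]
          have h1 : j + t * (a + b) ≤ ((T + t + 1 + (j + t * (a + b)).toNat : ℕ) : ℤ) := by omega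
          nlinarith
        classical
        have hsp := Nat.find_spec hex
        have hmin := fun m => Nat.find_min hex (m := m)
        obtain ⟨s, hs⟩ : ∃ s, Nat.find hex = s + 1 := ⟨Nat.find hex - 1, by omega⟩
        rw [hs] at hsp hmin
        have hts : t ≤ s := by omega
        have hlt2 : θ s + s * (a + b) < j + t * (a + b) := by
          by_contra hle
          rcases hts.eq_or_lt with rfl | hts'
          · linarith
          · exact hmin s (by omega) ⟨hts', by linarith⟩
        have hle2 := hsp.2
        push_cast at hle2
        have hs1 : 1 ≤ s := by omega
        have hnt := (hθ s hs1).2.2.2 (j + t * (a + b) - s * (a + b)) (by linarith) (by linarith)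
        have hnt2 := NT_period ((s : ℤ) - t) hnt
        obtain ⟨r, c, hj, hN⟩ := hnt2
        have hj' : c - r = j := by rw [hj]; ring
        have hsN : 1 ≤ NN a b p r c := by omega
        have av := avoid r c hsN
        rw [hN] at av
        refine ⟨r, c, hj', ?_, ?_⟩
        · rw [hqO]
          simp only [O]
          rw [hN, hj']
          have m1 := mono1 t s ht hts
          have m2 := (hθ s hs1).2.1
          refine ⟨by linarith, lt_of_le_of_ne ?_ ?_⟩
          · have : (1 : ℤ) * (a + b) ≤ t * (a + b) := by
              apply mul_le_mul_of_nonneg_right _ e0.le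
              exact_mod_cast ht
            linarith
          · intro hh
            apply av (-s)
            rw [hj', hh]; ring
        · rw [hqO]
          simp only [O]
          rw [NN_shift, hN]
          rintro ⟨_, h⟩
          rw [← hj'] at hlt2
          linarith
    intro t ht j
    rw [hpos t ht, hpos t ht]
    omega

/-! Translation to the statement -/

theorem ladder_ncard {e y : ℤ} (hy : 0 < y) (hye : y < e) (p : ℕ → ℕ) (r c : ℤ) (n : ℤ) :
    ({x | x ∈ Ladder e y r c ∧ x ∈ cells p ∧ x.1 ≤ n}).ncard =
      {k | k ∈ II (e - y) y r c ∧ r - k * (e - y) ≤ n}.ncard -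
        {k | k ∈ SS (e - y) y p r c ∧ r - k * (e - y) ≤ n}.ncard := by
  have ha : 0 < e - y := by omega
  have hfin : {k | k ∈ SS (e - y) y p r c ∧ r - k * (e - y) ≤ n}.Finite :=
    (SS_finite ha hy p r c).subset (fun k hk => hk.1)
  have hsub : {k | k ∈ SS (e - y) y p r c ∧ r - k * (e - y) ≤ n} ⊆
      {k | k ∈ II (e - y) y r c ∧ r - k * (e - y) ≤ n} :=
    fun k hk => ⟨SS_sub_II p r c hk.1, hk.2⟩
  rw [← Set.ncard_sdiff hsub hfin]
  have himg : {x | x ∈ Ladder e y r c ∧ x ∈ cells p ∧ x.1 ≤ n} =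
      (fun k : ℤ => (r - k * (e - y), c + k * y)) ''
        ({k | k ∈ II (e - y) y r c ∧ r - k * (e - y) ≤ n} \
        {k | k ∈ SS (e - y) y p r c ∧ r - k * (e - y) ≤ n}) := by
    ext x
    constructor
    · rintro ⟨⟨k, rfl⟩, hc, hn⟩
      have hrw : r + k * (y - e) = r - k * (e - y) := by ring
      rw [hrw] at hc hn ⊢
      have h1 : 1 ≤ r - k * (e - y) := hc.1
      have h2 : 1 ≤ c + k * y := hc.2.1
      refine ⟨k, ⟨⟨⟨h1, h2⟩, hn⟩, ?_⟩, rfl⟩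
      rintro ⟨hS, _⟩
      exact (cells_iff h1 h2).1 hc hS
    · rintro ⟨k, ⟨⟨hI, hn⟩, hS⟩, rfl⟩
      refine ⟨⟨k, by ext <;> simp; ring⟩, (cells_iff hI.1 hI.2).2 (fun hO => hS ⟨hO, hn⟩), hn⟩
  rw [himg, Set.ncard_image_of_injective]
  intro k l hkl
  simp only [Prod.mk.injEq] at hkl
  have := hkl.2
  have : k * y = l * y := by linarith
  exact mul_right_cancel₀ hy.ne' this

theorem ladder_ncard' {e y : ℤ} (hy : 0 < y) (hye : y < e) (p : ℕ → ℕ) (r c : ℤ) :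
    (Ladder e y r c ∩ cells p).ncard =
      (II (e - y) y r c).ncard - NN (e - y) y p r c := by
  have ha : 0 < e - y := by omega
  obtain ⟨M, hM⟩ := ((II_finite ha hy r c).image (fun k => r - k * (e - y))).bddAbove
  have hM' : ∀ k ∈ II (e - y) y r c, r - k * (e - y) ≤ M := fun k hk =>
    hM (Set.mem_image_of_mem _ hk)
  have := ladder_ncard hy hye p r c M
  have h1 : {k | k ∈ II (e - y) y r c ∧ r - k * (e - y) ≤ M} = II (e - y) y r c := by
    ext k; exact ⟨fun h => h.1, fun h => ⟨h, hM' k h⟩⟩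
  have h2 : {k | k ∈ SS (e - y) y p r c ∧ r - k * (e - y) ≤ M} = SS (e - y) y p r c := by
    ext k; exact ⟨fun h => h.1, fun h => ⟨h, hM' k (SS_sub_II p r c h)⟩⟩
  have h3 : {x | x ∈ Ladder e y r c ∧ x ∈ cells p ∧ x.1 ≤ M} = Ladder e y r c ∩ cells p := by
    ext x
    refine ⟨fun h => ⟨h.1, h.2.1⟩, fun h => ⟨h.1, h.2, ?_⟩⟩
    obtain ⟨⟨k, rfl⟩, hc⟩ := h
    have := hM' k ⟨by have := hc.1; simp only at this; linarith, hc.2.1⟩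
    simp only
    linarith
  rw [h1, h2, h3] at this
  exact this

theorem equiv_iff {e y : ℤ} (hy : 0 < y) (hye : y < e) (p q : ℕ → ℕ) :
    LadderEquiv e y p q ↔ ∀ r c, NN (e - y) y p r c = NN (e - y) y q r c := by
  have ha : 0 < e - y := by omega
  have hle : ∀ (p : ℕ → ℕ) r c, NN (e - y) y p r c ≤ (II (e - y) y r c).ncard := fun p r c =>
    Set.ncard_le_ncard (SS_sub_II p r c) (II_finite ha hy r c)
  unfold LadderEquiv
  refine forall_congr' fun r => forall_congr' fun c => ?_
  rw [ladder_ncard' hy hye, ladder_ncard' hy hye]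
  have := hle p r c
  have := hle q r c
  omega

theorem fiber_le {α β : Type*} {A B : Set α} (hA : A.Finite) (hB : B.Finite) (f : α → β)
    (h : ∀ u, {x | x ∈ A ∧ f x = u}.ncard ≤ {x | x ∈ B ∧ f x = u}.ncard) :
    A.ncard ≤ B.ncard := by
  classical
  lift A to Finset α using hA
  lift B to Finset α using hB
  rw [Set.ncard_coe_finset, Set.ncard_coe_finset,
    Finset.card_eq_sum_card_fiberwise (f := f) (t := A.image f ∪ B.image f) (fun x hx => by
      simp only [Finset.coe_union, Finset.coe_image, Set.mem_union]
      exact Or.inl ⟨x, hx, rfl⟩),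
    Finset.card_eq_sum_card_fiberwise (s := B) (f := f) (t := A.image f ∪ B.image f) (fun x hx => by
      simp only [Finset.coe_union, Finset.coe_image, Set.mem_union]
      exact Or.inr ⟨x, hx, rfl⟩)]
  apply Finset.sum_le_sum
  intro u _
  have h1 := h u
  have e1 : ∀ C : Finset α, {x | x ∈ (C : Set α) ∧ f x = u} = ((C.filter (fun x => f x = u) : Finset α) : Set α) := by
    intro C; ext x; simp
  rw [e1, e1, Set.ncard_coe_finset, Set.ncard_coe_finset] at h1
  exact h1

theorem row_sum (p : ℕ → ℕ) (n : ℕ) :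
    {x | x ∈ cells p ∧ x.1 ≤ (n : ℤ)}.Finite ∧
    {x | x ∈ cells p ∧ x.1 ≤ (n : ℤ)}.ncard = ∑ r ∈ Finset.Icc 1 n, p r := by
  induction n with
  | zero =>
    have : {x | x ∈ cells p ∧ x.1 ≤ ((0 : ℕ) : ℤ)} = ∅ := by
      ext x
      constructor
      · rintro ⟨h1, h2⟩
        have := h1.1
        push_cast at h2
        omega
      · intro h; exact absurd h (Set.notMem_empty x)
    rw [this]; simp
  | succ n ih =>
    have hU : {x | x ∈ cells p ∧ x.1 ≤ ((n + 1 : ℕ) : ℤ)} =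
        {x | x ∈ cells p ∧ x.1 ≤ (n : ℤ)} ∪
        (((Finset.Icc (1 : ℤ) (p (n + 1))).image (fun c => ((n + 1 : ℤ), c)) :
          Finset (ℤ × ℤ)) : Set (ℤ × ℤ)) := by
      ext ⟨r, c⟩
      simp only [Set.mem_union, Finset.coe_image, Set.mem_image, Finset.coe_Icc, Set.mem_Icc]
      constructor
      · rintro ⟨h1, h2⟩
        simp only at h2
        push_cast at h2
        by_cases hr : r ≤ n
        · exact Or.inl ⟨h1, hr⟩
        · have : r = n + 1 := by omega
          subst this
          refine Or.inr ⟨c, ⟨h1.2.1, ?_⟩, rfl⟩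
          have := h1.2.2
          simpa using this
      · rintro (⟨h1, h2⟩ | ⟨c', ⟨h1, h2⟩, h3⟩)
        · refine ⟨h1, ?_⟩
          simp only at h2 ⊢
          push_cast; omega
        · simp only [Prod.mk.injEq] at h3
          obtain ⟨rfl, rfl⟩ := h3
          refine ⟨⟨by simp only; omega, h1, ?_⟩, by push_cast; exact le_rfl⟩
          simpa using h2
    rw [hU]
    refine ⟨ih.1.union (Finset.finite_toSet _), ?_⟩
    rw [Set.ncard_union_eq _ ih.1 (Finset.finite_toSet _), ih.2, Set.ncard_coe_finset,
      Finset.card_image_of_injective _ (fun c c' h => by simpa using h),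
      Finset.sum_Icc_succ_top (by omega)]
    · simp
    · rw [Set.disjoint_left]
      rintro ⟨r, c⟩ ⟨h1, h2⟩ h3
      simp only [Finset.coe_image, Set.mem_image, Prod.mk.injEq] at h3
      obtain ⟨c', _, h4, _⟩ := h3
      simp only at h2
      omega

theorem psize_eq {p : ℕ → ℕ} (hp : IsPartition p) :
    ∃ N : ℕ, ∀ n, N ≤ n → psize p = ∑ r ∈ Finset.Icc 1 n, p r := by
  obtain ⟨N, hN⟩ := hp.2.2
  refine ⟨N, fun n hn => tsum_eq_sum ?_⟩
  intro r hr
  by_cases h0 : r = 0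
  · rw [h0, hp.1]
  · apply hN
    simp only [Finset.mem_Icc] at hr
    omega

def linv (e y : ℤ) (x : ℤ × ℤ) : ℤ × ℤ := (x.1 + (x.2 / y) * (e - y), x.2 % y)

theorem fiber_ladder {e y : ℤ} (hy : 0 < y) (A : Set (ℤ × ℤ)) (u : ℤ × ℤ) :
    {x | x ∈ A ∧ linv e y x = u} = ∅ ∧ ¬ (0 ≤ u.2 ∧ u.2 < y) ∨
    {x | x ∈ A ∧ linv e y x = u} = {x | x ∈ Ladder e y u.1 u.2 ∧ x ∈ A} := by
  by_cases hu : 0 ≤ u.2 ∧ u.2 < y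
  · right
    ext x
    constructor
    · rintro ⟨hA, rfl⟩
      refine ⟨⟨x.2 / y, ?_⟩, hA⟩
      have := Int.emod_add_mul_ediv x.2 y
      ext
      · simp only [linv]; ring
      · simp only [linv]; linarith
    · rintro ⟨⟨k, rfl⟩, hA⟩
      refine ⟨hA, ?_⟩
      have h1 : (u.2 + k * y) / y = k := by
        rw [Int.add_mul_ediv_right _ _ hy.ne', Int.ediv_eq_zero_of_lt hu.1 hu.2, zero_add]
      have h2 : (u.2 + k * y) % y = u.2 := by
        rw [Int.add_mul_emod_self_right, Int.emod_eq_of_lt hu.1 hu.2]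
      ext
      · simp only [linv, h1]; ring
      · simp only [linv, h2]
  · left
    refine ⟨?_, hu⟩
    rw [Set.eq_empty_iff_forall_notMem]
    rintro x ⟨_, rfl⟩
    exact hu ⟨Int.emod_nonneg _ hy.ne', Int.emod_lt_of_pos _ hy⟩

theorem sum_le_of_fiber {e y : ℤ} (hy : 0 < y) {m q : ℕ → ℕ} (n : ℕ)
    (h : ∀ r c, ({x | x ∈ Ladder e y r c ∧ x ∈ cells q ∧ x.1 ≤ (n : ℤ)}).ncard ≤
      ({x | x ∈ Ladder e y r c ∧ x ∈ cells m ∧ x.1 ≤ (n : ℤ)}).ncard) :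
    ∑ r ∈ Finset.Icc 1 n, q r ≤ ∑ r ∈ Finset.Icc 1 n, m r := by
  rw [← (row_sum q n).2, ← (row_sum m n).2]
  apply fiber_le (row_sum q n).1 (row_sum m n).1 (linv e y)
  intro u
  rcases fiber_ladder (e := e) hy {x | x ∈ cells q ∧ x.1 ≤ (n : ℤ)} u with ⟨h1, _⟩ | h1
  · rw [h1]; simp
  · rcases fiber_ladder (e := e) hy {x | x ∈ cells m ∧ x.1 ≤ (n : ℤ)} u with ⟨h2, h3⟩ | h2
    · rcases fiber_ladder (e := e) hy {x | x ∈ cells q ∧ x.1 ≤ (n : ℤ)} u with ⟨h1, _⟩ | _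
      · rw [h1]; simp
      · have : {x | x ∈ {x | x ∈ cells q ∧ x.1 ≤ (n : ℤ)} ∧ linv e y x = u} = ∅ := by
          rw [Set.eq_empty_iff_forall_notMem]
          rintro x ⟨_, rfl⟩
          exact h3 ⟨Int.emod_nonneg _ hy.ne', Int.emod_lt_of_pos _ hy⟩
        rw [this]; simp
    · rw [h1, h2]
      exact h u.1 u.2

theorem dom_le {e y : ℤ} (hy : 0 < y) (hye : y < e) {m q : ℕ → ℕ} (hm : IsPartition m)
    (hq : IsPartition q) (hN : ∀ r c, NN (e - y) y m r c = NN (e - y) y q r c)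
    (h : Restr (e - y) y q) (n : ℕ) :
    ∑ r ∈ Finset.Icc 1 n, q r ≤ ∑ r ∈ Finset.Icc 1 n, m r := by
  have ha : 0 < e - y := by omega
  apply sum_le_of_fiber (e := e) hy n
  intro r c
  rw [ladder_ncard hy hye, ladder_ncard hy hye]
  apply Nat.sub_le_sub_left
  -- the row condition is a lower bound for k
  obtain ⟨k0, hk0⟩ : ∃ k0 : ℤ, ∀ k : ℤ, r - k * (e - y) ≤ n ↔ k0 ≤ k := by
    refine ⟨-((n - r) / (e - y)), fun k => ?_⟩
    rw [neg_le, Int.le_ediv_iff_mul_le ha]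
    constructor <;> intro h <;> linarith
  simp only [hk0]
  exact ladder_le ha hy hq h hm hN r c k0

theorem psize_le {e y : ℤ} (hy : 0 < y) (hye : y < e) {m q : ℕ → ℕ} (hm : IsPartition m)
    (hq : IsPartition q) (hE : LadderEquiv e y q m) : psize q ≤ psize m := by
  obtain ⟨N1, h1⟩ := psize_eq hm
  obtain ⟨N2, h2⟩ := psize_eq hq
  obtain ⟨M1, hM1, b1⟩ := exists_box hm
  obtain ⟨M2, hM2, b2⟩ := exists_box hq
  set n := N1 + N2 + M1.toNat + M2.toNat with hn
  rw [h1 n (by omega), h2 n (by omega)]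
  apply sum_le_of_fiber (e := e) hy n
  intro r c
  have hh : ∀ p : ℕ → ℕ, ∀ M : ℤ, M ≤ n →
      (∀ r c : ℤ, 1 ≤ r → 1 ≤ c → (M ≤ r ∨ M ≤ c) → OutC p r c) →
      {x | x ∈ Ladder e y r c ∧ x ∈ cells p ∧ x.1 ≤ (n : ℤ)} = Ladder e y r c ∩ cells p := by
    intro p M hMn hb
    ext x
    refine ⟨fun h => ⟨h.1, h.2.1⟩, fun h => ⟨h.1, h.2, ?_⟩⟩
    by_contra hlt
    obtain ⟨x1, x2⟩ := x
    exact (cells_iff h.2.1 h.2.2.1).1 h.2 (hb _ _ h.2.1 h.2.2.1 (by simp only at hlt; left; omega))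
  rw [hh q M2 (by omega) b2, hh m M1 (by omega) b1, hE r c]

theorem part_ext {p q : ℕ → ℕ} (hp : IsPartition p) (hq : IsPartition q)
    (h : ∀ n, ∑ r ∈ Finset.Icc 1 n, p r = ∑ r ∈ Finset.Icc 1 n, q r) : p = q := by
  funext n
  cases n with
  | zero => rw [hp.1, hq.1]
  | succ n =>
    have h1 := h (n + 1)
    rw [Finset.sum_Icc_succ_top (by omega), Finset.sum_Icc_succ_top (by omega), h n] at h1
    omega

/-- Each `(e,y)`-ladder class contains a unique `(e,y)`-restricted partition, and
this partition is dominated by every partition in the class. -/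
theorem ladder_class_restrictisation (e y : ℕ) (he : 2 ≤ e) (hy1 : 1 ≤ y) (hy2 : y ≤ e - 1)
    (p : ℕ → ℕ) (hp : IsPartition p) :
    ∃ q : ℕ → ℕ, (IsPartition q ∧ LadderEquiv (e : ℤ) (y : ℤ) p q ∧ EYRestricted e y q) ∧
      (∀ q' : ℕ → ℕ, IsPartition q' → LadderEquiv (e : ℤ) (y : ℤ) p q' → EYRestricted e y q' →
        q' = q) ∧
      (∀ m : ℕ → ℕ, IsPartition m → LadderEquiv (e : ℤ) (y : ℤ) p m → Dominates m q) := by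
  have hye : y < e := by omega
  have hy : (0 : ℤ) < y := by omega
  have hye' : (y : ℤ) < e := by omega
  have ha : (0 : ℤ) < (e : ℤ) - y := by omega
  obtain ⟨q, hq, hN, hR⟩ := existence ha hy hp
  have hE : LadderEquiv (e : ℤ) (y : ℤ) p q := (equiv_iff hy hye' p q).2 hN
  refine ⟨q, ⟨hq, hE, of_restr hy1 hye hq hR⟩, ?_, ?_⟩
  · intro q' hq' hE' hR'
    have hR2 := restr_of hy1 hye hq' hR'
    have hN' := (equiv_iff hy hye' p q').1 hE'
    apply part_ext hq' hq
    intro n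
    apply le_antisymm
    · exact dom_le hy hye' hq hq' (fun r c => by rw [← hN, hN']) hR2 n
    · exact dom_le hy hye' hq' hq (fun r c => by rw [← hN, hN']) hR n
  · intro m hm hEm
    have hNm := (equiv_iff hy hye' p m).1 hEm
    have hqm : LadderEquiv (e : ℤ) (y : ℤ) q m := fun r c => (hE r c).symm.trans (hEm r c)
    have hmq : LadderEquiv (e : ℤ) (y : ℤ) m q := fun r c => (hqm r c).symm
    exact ⟨le_antisymm (psize_le hy hye' hq hm hmq) (psize_le hy hye' hm hq hqm),
      fun n => dom_le hy hye' hm hq (fun r c => by rw [← hN, hNm]) hR n⟩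
end
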